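/- Let (H,A) be a compatible weak matched pair. Then the coproduct Δ on A#H maps A♯H into (A♯H)⊗(A♯H); more precisely, Δ(x♯h) = x₁♯(h₁)⁰ ⊗ (x₂(h₁)¹)♯h₂ for all x ∈ A, h ∈ H. Consequently Δ restricts to a coassociative coproduct on A♯H. -/

import Mathlib

open TensorProduct

noncomputable section

namespace WeakSmash

variable (k : Type*) [Field k]

/-- A weak bialgebra structure on the `k`-algebra `H`. -/
structure WeakBialgebra (H : Type*) [Ring H] [Algebra k H] where
  comul : H →ₗ[k] H ⊗[k] H
  counit : H →ₗ[k] k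
  coassoc : ∀ h : H,
    (TensorProduct.assoc k H H H) ((LinearMap.rTensor H comul) (comul h)) =
      (LinearMap.lTensor H comul) (comul h)
  counit_comul : ∀ h : H,
    (TensorProduct.lid k H) ((LinearMap.rTensor H counit) (comul h)) = h
  comul_counit : ∀ h : H,
    (TensorProduct.rid k H) ((LinearMap.lTensor H counit) (comul h)) = h
  comul_mul : ∀ h g : H, comul (h * g) = comul h * comul g
  counit_weak : ∀ h g l : H,
    counit (h * g * l) =
      LinearMap.mul' k k
        ((TensorProduct.map (counit ∘ₗ LinearMap.mulLeft k h)
            (counit ∘ₗ LinearMap.mulRight k l)) (comul g))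
  counit_weak' : ∀ h g l : H,
    counit (h * g * l) =
      LinearMap.mul' k k
        ((TensorProduct.map (counit ∘ₗ LinearMap.mulLeft k h)
            (counit ∘ₗ LinearMap.mulRight k l)) ((TensorProduct.comm k H H) (comul g)))
  comul_one_left :
    ((TensorProduct.assoc k H H H) (comul 1 ⊗ₜ[k] (1 : H))) * ((1 : H) ⊗ₜ[k] comul 1) =
      (LinearMap.lTensor H comul) (comul 1)
  comul_one_right :
    ((1 : H) ⊗ₜ[k] comul 1) * ((TensorProduct.assoc k H H H) (comul 1 ⊗ₜ[k] (1 : H))) =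
      (LinearMap.lTensor H comul) (comul 1)

variable {k}

namespace WeakBialgebra

variable {H : Type*} [Ring H] [Algebra k H]

/-- The target counital map `εt h = ε(1₁ h) 1₂`. -/
def εt (W : WeakBialgebra k H) : H →ₗ[k] H :=
  (TensorProduct.lid k H).toLinearMap ∘ₗ LinearMap.rTensor H W.counit ∘ₗ
    LinearMap.mulLeft k (W.comul 1) ∘ₗ (TensorProduct.mk k H H).flip 1

/-- The source counital map `εs h = 1₁ ε(h 1₂)`. -/
def εs (W : WeakBialgebra k H) : H →ₗ[k] H :=
  (TensorProduct.rid k H).toLinearMap ∘ₗ LinearMap.lTensor H W.counit ∘ₗ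
    LinearMap.mulRight k (W.comul 1) ∘ₗ TensorProduct.mk k H H 1

/-- Cocommutativity of a weak bialgebra. -/
def Cocomm (W : WeakBialgebra k H) : Prop :=
  ∀ h : H, (TensorProduct.comm k H H) (W.comul h) = W.comul h

/-- `S` is an antipode for `W`, making it a weak Hopf algebra. -/
structure IsAntipode (W : WeakBialgebra k H) (S : H →ₗ[k] H) : Prop where
  mul_antipode : ∀ h : H,
    LinearMap.mul' k H ((LinearMap.lTensor H S) (W.comul h)) = W.εt h
  antipode_mul : ∀ h : H,
    LinearMap.mul' k H ((LinearMap.rTensor H S) (W.comul h)) = W.εs h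
  antipode_mid : ∀ h : H,
    LinearMap.mul' k H
      ((TensorProduct.map S (LinearMap.mul' k H ∘ₗ LinearMap.lTensor H S))
        ((LinearMap.lTensor H W.comul) (W.comul h))) = S h

/-- `α` is a left integral: `h α = εt(h) α`. -/
def IsLeftIntegral (W : WeakBialgebra k H) (α : H) : Prop :=
  ∀ h : H, h * α = W.εt h * α

end WeakBialgebra

section MatchedPair

variable (k)
variable {H A : Type*} [Ring H] [Algebra k H] [Ring A] [Algebra k A]

/-- `A` is a left `H`-module algebra via the action `act`. -/
structure IsModuleAlgebra (WH : WeakBialgebra k H) (act : H →ₗ[k] A →ₗ[k] A) : Prop where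
  one_act : ∀ a : A, act 1 a = a
  act_mul : ∀ (h : H) (a b : A),
    act h (a * b) =
      LinearMap.mul' k A ((TensorProduct.map (act.flip a) (act.flip b)) (WH.comul h))
  act_act : ∀ (h g : H) (a : A), act h (act g a) = act (h * g) a
  act_unit : ∀ h : H, act h 1 = act (WH.εt h) 1

/-- The map `h ↦ ε(h⁰) h¹`. -/
def coactCounit (WH : WeakBialgebra k H) (coact : H →ₗ[k] H ⊗[k] A) : H →ₗ[k] A :=
  (TensorProduct.lid k A).toLinearMap ∘ₗ LinearMap.rTensor A WH.counit ∘ₗ coact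

/-- `H` is a right `A`-comodule coalgebra via the coaction `coact`. -/
structure IsComoduleCoalgebra (WH : WeakBialgebra k H) (WA : WeakBialgebra k A)
    (coact : H →ₗ[k] H ⊗[k] A) : Prop where
  counit_coact : ∀ h : H,
    (TensorProduct.rid k H) ((LinearMap.lTensor H WA.counit) (coact h)) = h
  comul_coact : ∀ h : H,
    (LinearMap.rTensor A WH.comul) (coact h) =
      (LinearMap.lTensor (H ⊗[k] H) (LinearMap.mul' k A))
        ((TensorProduct.tensorTensorTensorComm k H A H A)
          ((TensorProduct.map coact coact) (WH.comul h)))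
  coact_coact : ∀ h : H,
    (TensorProduct.assoc k H A A) ((LinearMap.rTensor A coact) (coact h)) =
      (LinearMap.lTensor H WA.comul) (coact h)
  coact_counit : ∀ h : H,
    coactCounit k WH coact h = WA.εs (coactCounit k WH coact h)

/-- The map `(h₁ ⊗ h₂) ⊗ (x₁ ⊗ x₂) ↦ (h₁⁰ · x₁) ⊗ (h₁¹ (h₂ · x₂))`. -/
def pairMapA (act : H →ₗ[k] A →ₗ[k] A) (coact : H →ₗ[k] H ⊗[k] A) :
    (H ⊗[k] H) ⊗[k] (A ⊗[k] A) →ₗ[k] A ⊗[k] A :=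
  LinearMap.lTensor A (LinearMap.mul' k A) ∘ₗ
  (TensorProduct.assoc k A A A).toLinearMap ∘ₗ
  LinearMap.rTensor A
    (LinearMap.rTensor A (TensorProduct.lift act) ∘ₗ
      (TensorProduct.assoc k H A A).symm.toLinearMap ∘ₗ
      LinearMap.lTensor H (TensorProduct.comm k A A).toLinearMap ∘ₗ
      (TensorProduct.assoc k H A A).toLinearMap) ∘ₗ
  TensorProduct.map (LinearMap.rTensor A coact) (TensorProduct.lift act) ∘ₗ
  (TensorProduct.tensorTensorTensorComm k H H A A).toLinearMap

/-- The map `(h₁ ⊗ h₂) ⊗ (g⁰ ⊗ g¹) ↦ (h₁⁰ g⁰) ⊗ (h₁¹ (h₂ · g¹))`. -/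
def pairMapH (act : H →ₗ[k] A →ₗ[k] A) (coact : H →ₗ[k] H ⊗[k] A) :
    (H ⊗[k] H) ⊗[k] (H ⊗[k] A) →ₗ[k] H ⊗[k] A :=
  LinearMap.lTensor H (LinearMap.mul' k A) ∘ₗ
  (TensorProduct.assoc k H A A).toLinearMap ∘ₗ
  LinearMap.rTensor A
    (LinearMap.rTensor A (LinearMap.mul' k H) ∘ₗ
      (TensorProduct.assoc k H H A).symm.toLinearMap ∘ₗ
      LinearMap.lTensor H (TensorProduct.comm k A H).toLinearMap ∘ₗ
      (TensorProduct.assoc k H A H).toLinearMap) ∘ₗ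
  TensorProduct.map (LinearMap.rTensor H coact) (TensorProduct.lift act) ∘ₗ
  (TensorProduct.tensorTensorTensorComm k H H H A).toLinearMap

/-- The iterated comultiplication `h ↦ h₁ ⊗ (h₂ ⊗ h₃)`. -/
def twoComul (WH : WeakBialgebra k H) : H →ₗ[k] H ⊗[k] (H ⊗[k] H) :=
  LinearMap.lTensor H WH.comul ∘ₗ WH.comul

/-- The iterated comultiplication `h ↦ h₁ ⊗ (h₂ ⊗ (h₃ ⊗ h₄))`. -/
def threeComul (WH : WeakBialgebra k H) : H →ₗ[k] H ⊗[k] (H ⊗[k] (H ⊗[k] H)) :=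
  LinearMap.lTensor H (LinearMap.lTensor H WH.comul) ∘ₗ LinearMap.lTensor H WH.comul ∘ₗ WH.comul

/-- Left-hand side of the matched pair condition (iii):
`(h₁·x)₁ ⊗ (h₂ g)⁰ ⊗ (h₁·x)₂ (h₂ g)¹`. -/
def mpLHS (WH : WeakBialgebra k H) (WA : WeakBialgebra k A)
    (act : H →ₗ[k] A →ₗ[k] A) (coact : H →ₗ[k] H ⊗[k] A) (h g : H) (x : A) :
    (A ⊗[k] H) ⊗[k] A :=
  LinearMap.lTensor (A ⊗[k] H) (LinearMap.mul' k A)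
    ((TensorProduct.tensorTensorTensorComm k A A H A)
      ((TensorProduct.map (WA.comul ∘ₗ act.flip x) (coact ∘ₗ LinearMap.mulRight k g))
        (WH.comul h)))

/-- Right-hand side of the matched pair condition (iii):
`(h₁⁰ · x₁) ⊗ (h₃⁰ g⁰) ⊗ (h₁¹ (h₂ · x₂) h₃¹ (h₄ · g¹))`. -/
def mpRHS (WH : WeakBialgebra k H) (WA : WeakBialgebra k A)
    (act : H →ₗ[k] A →ₗ[k] A) (coact : H →ₗ[k] H ⊗[k] A) (h g : H) (x : A) :
    (A ⊗[k] H) ⊗[k] A :=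
  LinearMap.lTensor (A ⊗[k] H) (LinearMap.mul' k A)
    ((TensorProduct.tensorTensorTensorComm k A A H A)
      ((TensorProduct.map
          (pairMapA k act coact ∘ₗ
            (TensorProduct.mk k (H ⊗[k] H) (A ⊗[k] A)).flip (WA.comul x))
          (pairMapH k act coact ∘ₗ
            (TensorProduct.mk k (H ⊗[k] H) (H ⊗[k] A)).flip (coact g)))
        ((TensorProduct.assoc k H H (H ⊗[k] H)).symm (threeComul k WH h))))

/-- `(H, A)` is a weak matched pair. -/
structure IsWeakMatchedPair (WH : WeakBialgebra k H) (WA : WeakBialgebra k A)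
    (act : H →ₗ[k] A →ₗ[k] A) (coact : H →ₗ[k] H ⊗[k] A) : Prop where
  moduleAlgebra : IsModuleAlgebra k WH act
  comoduleCoalgebra : IsComoduleCoalgebra k WH WA coact
  cond3 : ∀ (h g : H) (x : A),
    mpLHS k WH WA act coact h g x = mpRHS k WH WA act coact h g x
  cond4 : ∀ (h : H) (x : A), WA.εs (act h x) = WA.εs (act h 1) * WA.εs x
  cond5 :
    (LinearMap.rTensor H coact) (WH.comul 1) =
      (TensorProduct.map (LinearMap.lTensor H (coactCounit k WH coact))
          (LinearMap.mul' k H))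
        ((TensorProduct.tensorTensorTensorComm k H H H H)
          (WH.comul 1 ⊗ₜ[k] WH.comul 1))

/-- `(H, A)` is a compatible (abelian) weak matched pair. -/
structure IsCompatiblePair (WH : WeakBialgebra k H) (WA : WeakBialgebra k A)
    (act : H →ₗ[k] A →ₗ[k] A) (coact : H →ₗ[k] H ⊗[k] A) : Prop where
  pair : IsWeakMatchedPair k WH WA act coact
  cocomm : WH.Cocomm
  comm : ∀ a b : A, a * b = b * a
  compat1 : ∀ h : H,
    act h 1 =
      (TensorProduct.rid k A)
        ((TensorProduct.map (TensorProduct.lift act)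
            (WA.counit ∘ₗ TensorProduct.lift act))
          ((TensorProduct.tensorTensorTensorComm k H H A A)
            (WH.comul h ⊗ₜ[k] WA.comul 1)))
  compat2 : ∀ h g : H,
    (TensorProduct.map (act h) (act g)) (WA.comul 1) =
      (TensorProduct.map (LinearMap.mulLeft k (act h 1))
        (LinearMap.mulLeft k (act g 1))) (WA.comul 1)

/-- The smash product multiplication on `A ⊗ H`:
`(x ⊗ h) (y ⊗ g) = x (h₁ · y) ⊗ h₂ g`. -/
def smashMul (WH : WeakBialgebra k H) (act : H →ₗ[k] A →ₗ[k] A) :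
    (A ⊗[k] H) ⊗[k] (A ⊗[k] H) →ₗ[k] A ⊗[k] H :=
  LinearMap.rTensor H (LinearMap.mul' k A) ∘ₗ
  (TensorProduct.assoc k A A H).symm.toLinearMap ∘ₗ
  LinearMap.lTensor A
    (TensorProduct.map (TensorProduct.lift act) (LinearMap.mul' k H) ∘ₗ
      (TensorProduct.tensorTensorTensorComm k H H A H).toLinearMap) ∘ₗ
  (TensorProduct.assoc k A (H ⊗[k] H) (A ⊗[k] H)).toLinearMap ∘ₗ
  LinearMap.rTensor (A ⊗[k] H) (LinearMap.lTensor A WH.comul)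

/-- The smash coproduct on `A ⊗ H`:
`Δ(x ⊗ h) = (x₁ ⊗ h₁⁰) ⊗ (x₂ h₁¹ ⊗ h₂)`. -/
def smashComul (WH : WeakBialgebra k H) (WA : WeakBialgebra k A)
    (coact : H →ₗ[k] H ⊗[k] A) :
    A ⊗[k] H →ₗ[k] (A ⊗[k] H) ⊗[k] (A ⊗[k] H) :=
  (TensorProduct.assoc k (A ⊗[k] H) A H).toLinearMap ∘ₗ
  LinearMap.rTensor H (LinearMap.lTensor (A ⊗[k] H) (LinearMap.mul' k A)) ∘ₗ
  LinearMap.rTensor H (TensorProduct.tensorTensorTensorComm k A A H A).toLinearMap ∘ₗ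
  (TensorProduct.assoc k (A ⊗[k] A) (H ⊗[k] A) H).symm.toLinearMap ∘ₗ
  LinearMap.lTensor (A ⊗[k] A) (LinearMap.rTensor H coact) ∘ₗ
  TensorProduct.map WA.comul WH.comul

/-- The smash counit `ε(x ⊗ h) = ε(x) ε(h)`. -/
def smashCounit (WH : WeakBialgebra k H) (WA : WeakBialgebra k A) :
    A ⊗[k] H →ₗ[k] k :=
  LinearMap.mul' k k ∘ₗ TensorProduct.map WA.counit WH.counit

/-- The projection `u ↦ u (1_A # 1_H)` onto `A ♯ H`. -/
def projUnder (WH : WeakBialgebra k H) (act : H →ₗ[k] A →ₗ[k] A) :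
    A ⊗[k] H →ₗ[k] A ⊗[k] H :=
  smashMul k WH act ∘ₗ
    (TensorProduct.mk k (A ⊗[k] H) (A ⊗[k] H)).flip ((1 : A) ⊗ₜ[k] (1 : H))

/-- The projection `u ↦ (id ⊗ ε) Δ(u)` onto `overline(A # H)`. -/
def projBar (WH : WeakBialgebra k H) (WA : WeakBialgebra k A)
    (coact : H →ₗ[k] H ⊗[k] A) : A ⊗[k] H →ₗ[k] A ⊗[k] H :=
  (TensorProduct.rid k (A ⊗[k] H)).toLinearMap ∘ₗ
    LinearMap.lTensor (A ⊗[k] H) (smashCounit k WH WA) ∘ₗ smashComul k WH WA coact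

/-- The projection onto `A ♯♯ H`, i.e. `u ↦ (id ⊗ ε) Δ (u (1#1))`. -/
def projBoth (WH : WeakBialgebra k H) (WA : WeakBialgebra k A)
    (act : H →ₗ[k] A →ₗ[k] A) (coact : H →ₗ[k] H ⊗[k] A) :
    A ⊗[k] H →ₗ[k] A ⊗[k] H :=
  projBar k WH WA coact ∘ₗ projUnder k WH act

/-- Componentwise smash multiplication on `(A⊗H) ⊗ (A⊗H)`. -/
def smashMul2 (WH : WeakBialgebra k H) (act : H →ₗ[k] A →ₗ[k] A) :
    ((A ⊗[k] H) ⊗[k] (A ⊗[k] H)) ⊗[k] ((A ⊗[k] H) ⊗[k] (A ⊗[k] H)) →ₗ[k]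
      (A ⊗[k] H) ⊗[k] (A ⊗[k] H) :=
  TensorProduct.map (smashMul k WH act) (smashMul k WH act) ∘ₗ
    (TensorProduct.tensorTensorTensorComm k (A ⊗[k] H) (A ⊗[k] H)
      (A ⊗[k] H) (A ⊗[k] H)).toLinearMap

/-- Componentwise smash multiplication on threefold tensors. -/
def smashMul3 (WH : WeakBialgebra k H) (act : H →ₗ[k] A →ₗ[k] A) :
    ((A ⊗[k] H) ⊗[k] ((A ⊗[k] H) ⊗[k] (A ⊗[k] H))) ⊗[k]
      ((A ⊗[k] H) ⊗[k] ((A ⊗[k] H) ⊗[k] (A ⊗[k] H))) →ₗ[k]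
      (A ⊗[k] H) ⊗[k] ((A ⊗[k] H) ⊗[k] (A ⊗[k] H)) :=
  TensorProduct.map (smashMul k WH act) (smashMul2 k WH act) ∘ₗ
    (TensorProduct.tensorTensorTensorComm k (A ⊗[k] H)
      ((A ⊗[k] H) ⊗[k] (A ⊗[k] H)) (A ⊗[k] H)
      ((A ⊗[k] H) ⊗[k] (A ⊗[k] H))).toLinearMap

/-- The unit element `1_A ♯♯ 1_H` of `A ♯♯ H`. -/
def smashOne (WH : WeakBialgebra k H) (WA : WeakBialgebra k A)
    (act : H →ₗ[k] A →ₗ[k] A) (coact : H →ₗ[k] H ⊗[k] A) : A ⊗[k] H :=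
  projBoth k WH WA act coact ((1 : A) ⊗ₜ[k] (1 : H))

/-- The map `εt` of the weak bialgebra `A ♯♯ H`: `u ↦ ε(e₁ u) e₂` where `e = 1_A ♯♯ 1_H`. -/
def smashEpsT (WH : WeakBialgebra k H) (WA : WeakBialgebra k A)
    (act : H →ₗ[k] A →ₗ[k] A) (coact : H →ₗ[k] H ⊗[k] A) (u : A ⊗[k] H) :
    A ⊗[k] H :=
  (TensorProduct.lid k (A ⊗[k] H))
    ((LinearMap.rTensor (A ⊗[k] H)
        (smashCounit k WH WA ∘ₗ smashMul k WH act ∘ₗ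
          (TensorProduct.mk k (A ⊗[k] H) (A ⊗[k] H)).flip u))
      (smashComul k WH WA coact (smashOne k WH WA act coact)))

/-- The map `εs` of the weak bialgebra `A ♯♯ H`: `u ↦ e₁ ε(u e₂)` where `e = 1_A ♯♯ 1_H`. -/
def smashEpsS (WH : WeakBialgebra k H) (WA : WeakBialgebra k A)
    (act : H →ₗ[k] A →ₗ[k] A) (coact : H →ₗ[k] H ⊗[k] A) (u : A ⊗[k] H) :
    A ⊗[k] H :=
  (TensorProduct.rid k (A ⊗[k] H))
    ((LinearMap.lTensor (A ⊗[k] H)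
        (smashCounit k WH WA ∘ₗ smashMul k WH act ∘ₗ
          TensorProduct.mk k (A ⊗[k] H) (A ⊗[k] H) u))
      (smashComul k WH WA coact (smashOne k WH WA act coact)))

/-- The antipode of `A ♯♯ H`:
`S(x ⊗ h) = (1_A ♯♯ S_H(h⁰)) ((S_A(x h¹)) ♯♯ 1_H)`. -/
def smashAntipode (WH : WeakBialgebra k H) (WA : WeakBialgebra k A)
    (act : H →ₗ[k] A →ₗ[k] A) (coact : H →ₗ[k] H ⊗[k] A)
    (SH : H →ₗ[k] H) (SA : A →ₗ[k] A) : A ⊗[k] H →ₗ[k] A ⊗[k] H :=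
  smashMul k WH act ∘ₗ
  TensorProduct.map
    (projBoth k WH WA act coact ∘ₗ TensorProduct.mk k A H 1)
    (projBoth k WH WA act coact ∘ₗ (TensorProduct.mk k A H).flip 1) ∘ₗ
  (TensorProduct.comm k A H).toLinearMap ∘ₗ
  TensorProduct.map (SA ∘ₗ LinearMap.mul' k A) SH ∘ₗ
  (TensorProduct.assoc k A A H).symm.toLinearMap ∘ₗ
  LinearMap.lTensor A ((TensorProduct.comm k H A).toLinearMap ∘ₗ coact)

/-- LHS of condition (7): `(1_{H1} h⁰ · 1_A) ⊗ S_A(h¹) εs(1_{H2}¹) ⊗ 1_{H2}⁰`. -/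
def cond7LHS (WH : WeakBialgebra k H) (WA : WeakBialgebra k A)
    (act : H →ₗ[k] A →ₗ[k] A) (coact : H →ₗ[k] H ⊗[k] A)
    (SA : A →ₗ[k] A) (h : H) : (A ⊗[k] A) ⊗[k] H :=
  (TensorProduct.assoc k A A H).symm
    ((TensorProduct.map
        (act.flip 1 ∘ₗ LinearMap.mul' k H)
        ((TensorProduct.comm k H A).toLinearMap ∘ₗ
          LinearMap.lTensor H
            (LinearMap.mul' k A ∘ₗ TensorProduct.map SA WA.εs ∘ₗ
              (TensorProduct.comm k A A).toLinearMap) ∘ₗ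
          (TensorProduct.assoc k H A A).toLinearMap ∘ₗ
          LinearMap.rTensor A coact))
      ((TensorProduct.tensorTensorTensorComm k H H H A)
        (WH.comul 1 ⊗ₜ[k] coact h)))

/-- RHS of condition (7):
`εt(1_{H1}⁰ h⁰ · 1_A) ⊗ εt(h¹) εs(1_{H2}¹) 1_{H1}¹ ⊗ 1_{H2}⁰`. -/
def cond7RHS (WH : WeakBialgebra k H) (WA : WeakBialgebra k A)
    (act : H →ₗ[k] A →ₗ[k] A) (coact : H →ₗ[k] H ⊗[k] A) (h : H) :
    (A ⊗[k] A) ⊗[k] H :=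
  (TensorProduct.assoc k A A H).symm
   ((LinearMap.lTensor A (TensorProduct.comm k H A).toLinearMap)
    ((TensorProduct.assoc k A H A)
     ((LinearMap.lTensor (A ⊗[k] H)
        (LinearMap.mul' k A ∘ₗ (TensorProduct.comm k A A).toLinearMap))
      ((TensorProduct.tensorTensorTensorComm k A A H A)
       ((LinearMap.lTensor (A ⊗[k] A) (TensorProduct.comm k A H).toLinearMap)
        ((TensorProduct.map
            (LinearMap.rTensor A (WA.εt ∘ₗ act.flip 1 ∘ₗ LinearMap.mul' k H) ∘ₗ
              (TensorProduct.assoc k H H A).symm.toLinearMap ∘ₗ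
              LinearMap.lTensor H (TensorProduct.comm k A H).toLinearMap ∘ₗ
              (TensorProduct.assoc k H A H).toLinearMap)
            (LinearMap.rTensor H
                (LinearMap.mul' k A ∘ₗ (TensorProduct.comm k A A).toLinearMap ∘ₗ
                  TensorProduct.map WA.εs WA.εt) ∘ₗ
              (TensorProduct.assoc k A A H).symm.toLinearMap ∘ₗ
              LinearMap.lTensor A (TensorProduct.comm k H A).toLinearMap ∘ₗ
              (TensorProduct.assoc k A H A).toLinearMap ∘ₗ
              LinearMap.rTensor A (TensorProduct.comm k H A).toLinearMap))
          ((TensorProduct.tensorTensorTensorComm k (H ⊗[k] A) (H ⊗[k] A) H A)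
            (((TensorProduct.map coact coact) (WH.comul 1)) ⊗ₜ[k] coact h))))))))

/-- LHS of condition (8):
`εs(h₁¹ h₂¹) (S_H(h₁⁰) · 1_A) ⊗ S_H(h₂⁰) h₃`. -/
def cond8LHS (WH : WeakBialgebra k H) (WA : WeakBialgebra k A)
    (act : H →ₗ[k] A →ₗ[k] A) (coact : H →ₗ[k] H ⊗[k] A)
    (SH : H →ₗ[k] H) (h : H) : A ⊗[k] H :=
  LinearMap.rTensor H (LinearMap.mul' k A)
   ((TensorProduct.assoc k A A H).symm
    ((TensorProduct.map
        (WA.εs ∘ₗ LinearMap.mul' k A)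
        (TensorProduct.map (act.flip 1 ∘ₗ SH)
          (LinearMap.mul' k H ∘ₗ LinearMap.rTensor H SH)))
      ((TensorProduct.tensorTensorTensorComm k A H A (H ⊗[k] H))
        ((TensorProduct.map (TensorProduct.comm k H A).toLinearMap
            ((TensorProduct.assoc k A H H).toLinearMap ∘ₗ
              LinearMap.rTensor H (TensorProduct.comm k H A).toLinearMap))
          ((TensorProduct.map coact (LinearMap.rTensor H coact))
            (twoComul k WH h))))))

/-- RHS of condition (8):
`εs(h¹ 1_{H2}¹) εs(h⁰ 1_{H1} · 1_A) ⊗ 1_{H2}⁰`. -/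
def cond8RHS (WH : WeakBialgebra k H) (WA : WeakBialgebra k A)
    (act : H →ₗ[k] A →ₗ[k] A) (coact : H →ₗ[k] H ⊗[k] A) (h : H) :
    A ⊗[k] H :=
  LinearMap.rTensor H (LinearMap.mul' k A ∘ₗ (TensorProduct.comm k A A).toLinearMap)
   ((TensorProduct.assoc k A A H).symm
    ((TensorProduct.map
        (WA.εs ∘ₗ act.flip 1 ∘ₗ LinearMap.mul' k H)
        (LinearMap.rTensor H (WA.εs ∘ₗ LinearMap.mul' k A) ∘ₗ
          (TensorProduct.assoc k A A H).symm.toLinearMap ∘ₗ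
          LinearMap.lTensor A (TensorProduct.comm k H A).toLinearMap))
      ((TensorProduct.tensorTensorTensorComm k H A H (H ⊗[k] A))
        (coact h ⊗ₜ[k] (LinearMap.lTensor H coact) (WH.comul 1)))))

/-- The element `εs(t₁¹ (t₂ · 1_A)) ⊗ t₁⁰` of `A ⊗ H`. -/
def integralWitness (WH : WeakBialgebra k H) (WA : WeakBialgebra k A)
    (act : H →ₗ[k] A →ₗ[k] A) (coact : H →ₗ[k] H ⊗[k] A) (t : H) :
    A ⊗[k] H :=
  (TensorProduct.comm k H A)
    ((LinearMap.lTensor H (WA.εs ∘ₗ LinearMap.mul' k A))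
      ((TensorProduct.assoc k H A A)
        ((LinearMap.rTensor A coact)
          ((LinearMap.lTensor H (act.flip 1)) (WH.comul t)))))

end MatchedPair

end WeakSmash


namespace WeakSmash

section WeakBialgebraLemmas

variable {k A : Type*} [Field k] [Ring A] [Algebra k A]

lemma tensor_mul_comm {B C : Type*} [Ring B] [Algebra k B] [Ring C] [Algebra k C]
    (hB : ∀ a b : B, a * b = b * a) (hC : ∀ a b : C, a * b = b * a) (u v : B ⊗[k] C) :
    u * v = v * u := by
  induction u with
  | zero => simp
  | add x y hx hy => rw [add_mul, mul_add, hx, hy]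
  | tmul a b =>
    induction v with
    | zero => simp
    | add x y hx hy => rw [add_mul, mul_add, hx, hy]
    | tmul c d => simp [hB a c, hC b d]

namespace WeakBialgebra

variable (W : WeakBialgebra k A)

lemma εt_apply (b : A) :
    W.εt b = TensorProduct.lid k A (LinearMap.rTensor A W.counit (W.comul 1 * b ⊗ₜ[k] 1)) := rfl

lemma εs_apply (b : A) :
    W.εs b = TensorProduct.rid k A (LinearMap.lTensor A W.counit (1 ⊗ₜ[k] b * W.comul 1)) := rfl

lemma counit_mul_εt (a b : A) : W.counit (a * W.εt b) = W.counit (a * b) := by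
  have key : ∀ u : A ⊗[k] A,
      W.counit (a * TensorProduct.lid k A (LinearMap.rTensor A W.counit (u * b ⊗ₜ[k] 1))) =
        LinearMap.mul' k k
          ((TensorProduct.map (W.counit ∘ₗ LinearMap.mulLeft k a)
            (W.counit ∘ₗ LinearMap.mulRight k b)) ((TensorProduct.comm k A A) u)) := by
    intro u
    induction u with
    | zero => simp
    | add x y hx hy => simp only [add_mul, mul_add, map_add, hx, hy]
    | tmul c d => simp [mul_comm]
  rw [εt_apply, key, ← W.counit_weak', mul_one]

lemma counit_εs_mul (a b : A) : W.counit (W.εs a * b) = W.counit (a * b) := by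
  have key : ∀ u : A ⊗[k] A,
      W.counit (TensorProduct.rid k A (LinearMap.lTensor A W.counit (1 ⊗ₜ[k] a * u)) * b) =
        LinearMap.mul' k k
          ((TensorProduct.map (W.counit ∘ₗ LinearMap.mulLeft k a)
            (W.counit ∘ₗ LinearMap.mulRight k b)) ((TensorProduct.comm k A A) u)) := by
    intro u
    induction u with
    | zero => simp
    | add x y hx hy => simp only [add_mul, mul_add, map_add, hx, hy]
    | tmul c d => simp
  rw [εs_apply, key, ← W.counit_weak', mul_one]

lemma comul_εt (b : A) : W.comul (W.εt b) = W.εt b ⊗ₜ[k] 1 * W.comul 1 := by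
  set Φ : A ⊗[k] (A ⊗[k] A) →ₗ[k] A ⊗[k] A :=
    (TensorProduct.lid k (A ⊗[k] A)).toLinearMap ∘ₗ
      LinearMap.rTensor (A ⊗[k] A) (W.counit ∘ₗ LinearMap.mulRight k b) with hΦ
  have h₁ : ∀ u : A ⊗[k] A,
      W.comul (TensorProduct.lid k A (LinearMap.rTensor A W.counit (u * b ⊗ₜ[k] 1))) =
        Φ (LinearMap.lTensor A W.comul u) := by
    intro u
    induction u with
    | zero => simp
    | add x y hx hy => simp only [add_mul, map_add, hx, hy]
    | tmul c d => simp [hΦ]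
  have h₂ : ∀ u v : A ⊗[k] A,
      Φ (TensorProduct.assoc k A A A (u ⊗ₜ[k] 1) * 1 ⊗ₜ[k] v) =
        (TensorProduct.lid k A (LinearMap.rTensor A W.counit (u * b ⊗ₜ[k] 1))) ⊗ₜ[k] 1 * v := by
    intro u v
    induction u with
    | zero => simp
    | add x y hx hy =>
      simp only [add_mul, map_add, hx, hy, TensorProduct.add_tmul]
    | tmul c d =>
      simp only [hΦ, TensorProduct.assoc_tmul, Algebra.TensorProduct.tmul_mul_tmul, mul_one,
        LinearMap.comp_apply, LinearMap.rTensor_tmul, LinearMap.mulRight_apply,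
        LinearEquiv.coe_coe, TensorProduct.lid_tmul]
      rw [← TensorProduct.smul_tmul', smul_mul_assoc]
  rw [εt_apply, h₁, ← W.comul_one_left, h₂]

lemma comul_εs (b : A) : W.comul (W.εs b) = W.comul 1 * 1 ⊗ₜ[k] W.εs b := by
  set Φ : A ⊗[k] (A ⊗[k] A) →ₗ[k] A ⊗[k] A :=
    (TensorProduct.rid k (A ⊗[k] A)).toLinearMap ∘ₗ
      LinearMap.lTensor (A ⊗[k] A) (W.counit ∘ₗ LinearMap.mulLeft k b) ∘ₗ
      (TensorProduct.assoc k A A A).symm.toLinearMap with hΦ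
  have h₁ : ∀ u : A ⊗[k] A,
      W.comul (TensorProduct.rid k A (LinearMap.lTensor A W.counit (1 ⊗ₜ[k] b * u))) =
        Φ (TensorProduct.assoc k A A A (LinearMap.rTensor A W.comul u)) := by
    intro u
    induction u with
    | zero => simp
    | add x y hx hy => simp only [mul_add, map_add, hx, hy]
    | tmul c d => simp [hΦ]
  have h₂ : ∀ u v : A ⊗[k] A,
      Φ (TensorProduct.assoc k A A A (v ⊗ₜ[k] 1) * 1 ⊗ₜ[k] u) =
        v * 1 ⊗ₜ[k] (TensorProduct.rid k A (LinearMap.lTensor A W.counit (1 ⊗ₜ[k] b * u))) := by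
    intro u v
    induction u with
    | zero => simp
    | add x y hx hy =>
      simp only [mul_add, map_add, hx, hy, TensorProduct.tmul_add]
    | tmul c d =>
      induction v with
      | zero => simp
      | add x y hx hy => simp only [add_mul, map_add, hx, hy, TensorProduct.add_tmul]
      | tmul e f => simp [hΦ]
  rw [εs_apply, h₁, W.coassoc, ← W.comul_one_left, h₂]

/-- The map `a ⊗ (c ⊗ d) ↦ ε(b c) a ⊗ d`. -/
def counitMid (b : A) : A ⊗[k] (A ⊗[k] A) →ₗ[k] A ⊗[k] A :=
  LinearMap.lTensor A ((TensorProduct.lid k A).toLinearMap ∘ₗ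
    LinearMap.rTensor A (W.counit ∘ₗ LinearMap.mulLeft k b))

@[simp]
lemma counitMid_tmul (b a c d : A) :
    W.counitMid b (a ⊗ₜ[k] (c ⊗ₜ[k] d)) = a ⊗ₜ[k] (W.counit (b * c) • d) := rfl

lemma counitMid_one_lTensor (w : A ⊗[k] A) :
    W.counitMid 1 (LinearMap.lTensor A W.comul w) = w := by
  induction w with
  | zero => simp
  | add x y hx hy => simp only [map_add, hx, hy]
  | tmul a c =>
    have := W.counit_comul c
    simp only [counitMid, LinearMap.lTensor_tmul, LinearMap.mulLeft_one]
    exact congrArg _ this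

lemma counitMid_one_rTensor (w : A ⊗[k] A) :
    W.counitMid 1 (TensorProduct.assoc k A A A (LinearMap.rTensor A W.comul w)) = w := by
  induction w with
  | zero => simp
  | add x y hx hy => simp only [map_add, hx, hy]
  | tmul a c =>
    have key : ∀ u : A ⊗[k] A, W.counitMid 1 (TensorProduct.assoc k A A A (u ⊗ₜ[k] c)) =
        (TensorProduct.rid k A (LinearMap.lTensor A W.counit u)) ⊗ₜ[k] c := by
      intro u
      induction u with
      | zero => simp
      | add x y hx hy => simp only [map_add, hx, hy, TensorProduct.add_tmul]
      | tmul e f => simp [TensorProduct.smul_tmul]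
    rw [LinearMap.rTensor_tmul, key, W.comul_counit]

lemma comul_one_mul_comul (h : A) : W.comul 1 * W.comul h = W.comul h := by
  rw [← W.comul_mul, one_mul]

lemma comul_mul_comul_one (h : A) : W.comul h * W.comul 1 = W.comul h := by
  rw [← W.comul_mul, mul_one]

lemma lTensor_comul_mul (u v : A ⊗[k] A) :
    LinearMap.lTensor A W.comul (u * v) =
      LinearMap.lTensor A W.comul u * LinearMap.lTensor A W.comul v := by
  induction u with
  | zero => simp
  | add x y hx hy => simp only [map_add, add_mul, hx, hy]
  | tmul a c =>
    induction v with
    | zero => simp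
    | add x y hx hy => simp only [map_add, mul_add, hx, hy]
    | tmul e f => simp [W.comul_mul]

lemma assoc_rTensor_comul_mul (u v : A ⊗[k] A) :
    TensorProduct.assoc k A A A (LinearMap.rTensor A W.comul (u * v)) =
      TensorProduct.assoc k A A A (LinearMap.rTensor A W.comul u) *
        TensorProduct.assoc k A A A (LinearMap.rTensor A W.comul v) := by
  have h : ∀ x y : (A ⊗[k] A) ⊗[k] A, TensorProduct.assoc k A A A (x * y) =
      TensorProduct.assoc k A A A x * TensorProduct.assoc k A A A y :=
    map_mul (Algebra.TensorProduct.assoc k k k A A A)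
  rw [← h]
  congr 1
  induction u with
  | zero => simp
  | add x y hx hy => simp only [map_add, add_mul, hx, hy]
  | tmul a c =>
    induction v with
    | zero => simp
    | add x y hx hy => simp only [map_add, mul_add, hx, hy]
    | tmul e f => simp [W.comul_mul]

lemma counitMid_comul_one_eq_εt (hA : ∀ a b : A, a * b = b * a) (b : A) :
    W.counitMid b (LinearMap.lTensor A W.comul (W.comul 1)) = W.comul 1 * 1 ⊗ₜ[k] W.εt b := by
  have key : ∀ u v : A ⊗[k] A,
      W.counitMid b (TensorProduct.assoc k A A A (u ⊗ₜ[k] 1) * 1 ⊗ₜ[k] v) =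
        W.counitMid 1 (TensorProduct.assoc k A A A (u ⊗ₜ[k] 1) *
          1 ⊗ₜ[k] (W.εt b ⊗ₜ[k] 1 * v)) := by
    intro u v
    induction u with
    | zero => simp
    | add x y hx hy => simp only [map_add, add_mul, hx, hy, TensorProduct.add_tmul]
    | tmul a c =>
      induction v with
      | zero => simp
      | add x y hx hy => simp only [map_add, mul_add, hx, hy, TensorProduct.tmul_add]
      | tmul e f =>
        simp only [TensorProduct.assoc_tmul, Algebra.TensorProduct.tmul_mul_tmul, one_mul,
          mul_one, counitMid_tmul]
        rw [hA (W.εt b) e, ← mul_assoc c, counit_mul_εt, hA (c * e)]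
  rw [← W.comul_one_left, key, ← comul_εt, ← W.comul_one_mul_comul (W.εt b),
    ← one_mul (1 : A), ← Algebra.TensorProduct.tmul_mul_tmul, one_mul, ← mul_assoc,
    W.comul_one_left, ← LinearMap.lTensor_tmul, ← lTensor_comul_mul, counitMid_one_lTensor]

lemma counitMid_comul_one_eq_εs (hA : ∀ a b : A, a * b = b * a) (b : A) :
    W.counitMid b (LinearMap.lTensor A W.comul (W.comul 1)) = W.εs b ⊗ₜ[k] 1 * W.comul 1 := by
  have key : ∀ u v : A ⊗[k] A,
      W.counitMid b (TensorProduct.assoc k A A A (u ⊗ₜ[k] 1) * 1 ⊗ₜ[k] v) =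
        W.counitMid 1 (TensorProduct.assoc k A A A ((u * 1 ⊗ₜ[k] W.εs b) ⊗ₜ[k] 1) *
          1 ⊗ₜ[k] v) := by
    intro u v
    induction u with
    | zero => simp
    | add x y hx hy => simp only [map_add, add_mul, hx, hy, TensorProduct.add_tmul]
    | tmul a c =>
      induction v with
      | zero => simp
      | add x y hx hy => simp only [map_add, mul_add, hx, hy, TensorProduct.tmul_add]
      | tmul e f =>
        simp only [TensorProduct.assoc_tmul, Algebra.TensorProduct.tmul_mul_tmul, one_mul,
          mul_one, counitMid_tmul]
        rw [hA c (W.εs b), mul_assoc, counit_εs_mul]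
  have h : ∀ x y : (A ⊗[k] A) ⊗[k] A, TensorProduct.assoc k A A A (x * y) =
      TensorProduct.assoc k A A A x * TensorProduct.assoc k A A A y :=
    map_mul (Algebra.TensorProduct.assoc k k k A A A)
  rw [← W.comul_one_left, key, ← comul_εs, ← W.comul_mul_comul_one (W.εs b),
    ← one_mul (1 : A), ← Algebra.TensorProduct.tmul_mul_tmul, one_mul, h, mul_assoc,
    W.comul_one_left, ← W.coassoc, ← LinearMap.rTensor_tmul, ← assoc_rTensor_comul_mul,
    counitMid_one_rTensor]

lemma comul_one_mul_tmul_εt (hA : ∀ a b : A, a * b = b * a) (b : A) :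
    W.comul 1 * 1 ⊗ₜ[k] W.εt b = W.comul 1 * W.εs b ⊗ₜ[k] 1 := by
  rw [← W.counitMid_comul_one_eq_εt hA, W.counitMid_comul_one_eq_εs hA,
    tensor_mul_comm hA hA]

lemma comul_one_mul_counit (hA : ∀ a b : A, a * b = b * a) (v : A ⊗[k] A) :
    W.comul 1 * 1 ⊗ₜ[k] TensorProduct.lid k A
        (LinearMap.rTensor A W.counit (W.comul 1 * v)) =
      W.comul 1 * LinearMap.rTensor A W.εs v := by
  have key : ∀ (u : A ⊗[k] A) (b d : A), TensorProduct.lid k A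
      (LinearMap.rTensor A W.counit (u * b ⊗ₜ[k] d)) =
        TensorProduct.lid k A (LinearMap.rTensor A W.counit (u * b ⊗ₜ[k] 1)) * d := by
    intro u b d
    induction u with
    | zero => simp
    | add x y hx hy => simp only [map_add, add_mul, hx, hy]
    | tmul a c => simp
  induction v with
  | zero => simp
  | add x y hx hy => simp only [map_add, mul_add, hx, hy, TensorProduct.tmul_add]
  | tmul b d =>
    rw [key, ← εt_apply, LinearMap.rTensor_tmul]
    calc W.comul 1 * 1 ⊗ₜ[k] (W.εt b * d)
        = (W.comul 1 * 1 ⊗ₜ[k] W.εt b) * 1 ⊗ₜ[k] d := by simp [mul_assoc]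
      _ = W.comul 1 * W.εs b ⊗ₜ[k] d := by
        rw [W.comul_one_mul_tmul_εt hA]; simp [mul_assoc]

end WeakBialgebra

end WeakBialgebraLemmas

section Convolution

variable {k H A B C : Type*} [Field k] [Ring H] [Algebra k H] [Ring A] [Algebra k A]
  [Ring B] [Algebra k B] [Ring C] [Algebra k C]

/-- The convolution product `h ↦ f(h₁) g(h₂)`. -/
def conv (WH : WeakBialgebra k H) (f g : H →ₗ[k] B) : H →ₗ[k] B :=
  LinearMap.mul' k B ∘ₗ TensorProduct.map f g ∘ₗ WH.comul

lemma conv_apply (WH : WeakBialgebra k H) (f g : H →ₗ[k] B) (h : H) :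
    conv WH f g h = LinearMap.mul' k B (TensorProduct.map f g (WH.comul h)) := rfl

lemma map_conv (WH : WeakBialgebra k H) (φ : B →ₐ[k] C) (f g : H →ₗ[k] B) :
    φ.toLinearMap ∘ₗ conv WH f g = conv WH (φ.toLinearMap ∘ₗ f) (φ.toLinearMap ∘ₗ g) := by
  simp only [conv, ← LinearMap.comp_assoc]
  congr 1
  ext a b
  simp

/-- Two linear images of convolution products agree when they agree on factors. -/
lemma comp_conv_congr {X : Type*} [AddCommGroup X] [Module k X] (WH : WeakBialgebra k H)
    {f g : H →ₗ[k] B} {f' g' : H →ₗ[k] C} (L : B →ₗ[k] X) (L' : C →ₗ[k] X)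
    (hL : ∀ a b : H, L (f a * g b) = L' (f' a * g' b)) :
    L ∘ₗ conv WH f g = L' ∘ₗ conv WH f' g' := by
  simp only [conv, ← LinearMap.comp_assoc]
  congr 1
  ext a b
  simpa using hL a b

lemma conv_assoc (WH : WeakBialgebra k H) (f g l : H →ₗ[k] B) :
    conv WH (conv WH f g) l = conv WH f (conv WH g l) := by
  ext h
  have h₁ : ∀ t : H ⊗[k] H, LinearMap.mul' k B (TensorProduct.map (conv WH f g) l t) =
      LinearMap.mul' k B (TensorProduct.map f (LinearMap.mul' k B ∘ₗ TensorProduct.map g l)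
        (TensorProduct.assoc k H H H (LinearMap.rTensor H WH.comul t))) := by
    intro t
    induction t with
    | zero => simp
    | add x y hx hy => simp only [map_add, hx, hy]
    | tmul a b =>
      rw [TensorProduct.map_tmul, conv_apply, LinearMap.rTensor_tmul]
      generalize WH.comul a = u
      induction u with
      | zero => simp
      | add x y hx hy =>
        simp only [map_add, TensorProduct.add_tmul, hx, hy]
      | tmul c d => simp [mul_assoc]
  rw [conv_apply, h₁, WH.coassoc, conv_apply]
  generalize WH.comul h = t
  induction t with
  | zero => simp
  | add x y hx hy => simp only [map_add, hx, hy]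
  | tmul a b => simp [conv]

lemma conv_comm (WH : WeakBialgebra k H) (hH : WH.Cocomm) {f g : H →ₗ[k] B}
    (hfg : ∀ a b : H, f a * g b = g b * f a) : conv WH f g = conv WH g f := by
  ext h
  rw [conv_apply, ← hH h, conv_apply]
  generalize WH.comul h = t
  induction t with
  | zero => simp
  | add x y hx hy => simp only [map_add, hx, hy]
  | tmul a b => simp [hfg b a]

/-- The map `h ↦ f(h⁰) g(h¹)`. -/
def coactConv (coact : H →ₗ[k] H ⊗[k] A) (f : H →ₗ[k] B) (g : A →ₗ[k] B) : H →ₗ[k] B :=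
  LinearMap.mul' k B ∘ₗ TensorProduct.map f g ∘ₗ coact

lemma coactConv_apply (coact : H →ₗ[k] H ⊗[k] A) (f : H →ₗ[k] B) (g : A →ₗ[k] B) (h : H) :
    coactConv coact f g h = LinearMap.mul' k B (TensorProduct.map f g (coact h)) := rfl

/-- The comodule coalgebra axiom: `(f * g)(h⁰) c(h¹) = f(h₁⁰) c(h₁¹) g(h₂⁰) c(h₂¹)`. -/
lemma coactConv_conv {WH : WeakBialgebra k H} {WA : WeakBialgebra k A}
    {coact : H →ₗ[k] H ⊗[k] A} (hC : IsComoduleCoalgebra k WH WA coact)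
    (f g : H →ₗ[k] B) (c : A →ₐ[k] B) (hcg : ∀ a h, c a * g h = g h * c a) :
    coactConv coact (conv WH f g) c.toLinearMap =
      conv WH (coactConv coact f c.toLinearMap) (coactConv coact g c.toLinearMap) := by
  ext h
  set Φ : (H ⊗[k] H) ⊗[k] A →ₗ[k] B :=
    LinearMap.mul' k B ∘ₗ TensorProduct.map (LinearMap.mul' k B ∘ₗ TensorProduct.map f g)
      c.toLinearMap with hΦ
  have h₁ : coactConv coact (conv WH f g) c.toLinearMap h =
      Φ (LinearMap.rTensor A WH.comul (coact h)) := by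
    rw [coactConv_apply]
    generalize coact h = t
    induction t with
    | zero => simp
    | add x y hx hy => simp only [map_add, hx, hy]
    | tmul a b => simp [hΦ, conv]
  have h₂ : ∀ u v : H ⊗[k] A,
      Φ ((LinearMap.lTensor (H ⊗[k] H) (LinearMap.mul' k A))
        ((TensorProduct.tensorTensorTensorComm k H A H A) (u ⊗ₜ[k] v))) =
      LinearMap.mul' k B (TensorProduct.map f c.toLinearMap u) *
        LinearMap.mul' k B (TensorProduct.map g c.toLinearMap v) := by
    intro u v
    induction u with
    | zero => simp
    | add x y hx hy => simp only [map_add, add_mul, TensorProduct.add_tmul, hx, hy]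
    | tmul a b =>
      induction v with
      | zero => simp
      | add x y hx hy => simp only [map_add, mul_add, TensorProduct.tmul_add, hx, hy]
      | tmul d e =>
        simp only [hΦ, TensorProduct.tensorTensorTensorComm_tmul, LinearMap.lTensor_tmul,
          LinearMap.mul'_apply, LinearMap.comp_apply, TensorProduct.map_tmul,
          AlgHom.toLinearMap_apply, map_mul]
        rw [mul_assoc, ← mul_assoc (g d), ← hcg, mul_assoc, mul_assoc]
  rw [h₁, hC.comul_coact, conv_apply]
  generalize WH.comul h = t
  induction t with
  | zero => simp
  | add x y hx hy => simp only [map_add, hx, hy]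
  | tmul a b => rw [TensorProduct.map_tmul, h₂]; simp [coactConv]

/-- The map `h ↦ f(h⁰) g(h¹)`, as the image of the coaction. -/
lemma coactConv_eq_comp (coact : H →ₗ[k] H ⊗[k] A) {f : H →ₗ[k] B} {g : A →ₗ[k] B}
    (L : H ⊗[k] A →ₗ[k] B) (hL : ∀ a b, L (a ⊗ₜ[k] b) = f a * g b) :
    coactConv coact f g = L ∘ₗ coact := by
  rw [coactConv, ← LinearMap.comp_assoc]
  congr 1
  ext a b
  simp [hL]

end Convolution

section CompatiblePair

variable {k H A : Type*} [Field k] [Ring H] [Algebra k H] [Ring A] [Algebra k A]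

open Algebra.TensorProduct (includeLeft includeRight)

variable (k H A) in
/-- The inclusion `a ⊗ c ↦ (a ⊗ 1) ⊗ c`. -/
def inclAA : A ⊗[k] A →ₐ[k] (A ⊗[k] H) ⊗[k] A :=
  Algebra.TensorProduct.map includeLeft (AlgHom.id k A)

variable (k H A) in
/-- The inclusion `h ⊗ c ↦ (1 ⊗ h) ⊗ c`. -/
def inclHA : H ⊗[k] A →ₐ[k] (A ⊗[k] H) ⊗[k] A :=
  Algebra.TensorProduct.map includeRight (AlgHom.id k A)

@[simp]
lemma inclAA_tmul (a c : A) : inclAA k H A (a ⊗ₜ c) = (a ⊗ₜ 1) ⊗ₜ c := by simp [inclAA]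

@[simp]
lemma inclHA_tmul (h : H) (c : A) : inclHA k H A (h ⊗ₜ c) = (1 ⊗ₜ h) ⊗ₜ c := by simp [inclHA]

lemma lTensor_mul_comm_map (f : H →ₗ[k] A ⊗[k] A) (g : H →ₗ[k] H ⊗[k] A) (t : H ⊗[k] H) :
    LinearMap.lTensor (A ⊗[k] H) (LinearMap.mul' k A)
      ((TensorProduct.tensorTensorTensorComm k A A H A) (TensorProduct.map f g t)) =
    LinearMap.mul' k _ (TensorProduct.map ((inclAA k H A).toLinearMap ∘ₗ f)
      ((inclHA k H A).toLinearMap ∘ₗ g) t) := by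
  have key : ∀ (u : A ⊗[k] A) (v : H ⊗[k] A),
      LinearMap.lTensor (A ⊗[k] H) (LinearMap.mul' k A)
        ((TensorProduct.tensorTensorTensorComm k A A H A) (u ⊗ₜ v)) =
      inclAA k H A u * inclHA k H A v := by
    intro u v
    induction u with
    | zero => simp
    | add x y hx hy => simp only [map_add, add_mul, TensorProduct.add_tmul, hx, hy]
    | tmul a b =>
      induction v with
      | zero => simp
      | add x y hx hy => simp only [map_add, mul_add, TensorProduct.tmul_add, hx, hy]
      | tmul d e => simp
  induction t with
  | zero => simp
  | add x y hx hy => simp only [map_add, hx, hy]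
  | tmul a b => simp [key]

lemma assoc_symm_threeComul (WH : WeakBialgebra k H) (h : H) :
    (TensorProduct.assoc k H H (H ⊗[k] H)).symm (threeComul k WH h) =
      TensorProduct.map WH.comul WH.comul (WH.comul h) := by
  have key : ∀ t : (H ⊗[k] H) ⊗[k] H, (TensorProduct.assoc k H H (H ⊗[k] H)).symm
      (LinearMap.lTensor H (LinearMap.lTensor H WH.comul) (TensorProduct.assoc k H H H t)) =
      LinearMap.lTensor (H ⊗[k] H) WH.comul t := by
    intro t
    have : (TensorProduct.assoc k H H (H ⊗[k] H)).symm.toLinearMap ∘ₗ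
      LinearMap.lTensor H (LinearMap.lTensor H WH.comul) ∘ₗ
        (TensorProduct.assoc k H H H).toLinearMap = LinearMap.lTensor (H ⊗[k] H) WH.comul := by
      apply TensorProduct.ext_threefold
      intro a b c
      have h' : ∀ u : H ⊗[k] H, (TensorProduct.assoc k H H (H ⊗[k] H)).symm (a ⊗ₜ (b ⊗ₜ u)) =
          (a ⊗ₜ b) ⊗ₜ u := fun u => by simp
      simp [h']
    exact LinearMap.congr_fun this t
  rw [threeComul, LinearMap.comp_apply, LinearMap.comp_apply, ← WH.coassoc, key]
  generalize WH.comul h = t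
  induction t with
  | zero => simp
  | add x y hx hy => simp only [map_add, hx, hy]
  | tmul a b => simp

variable {WH : WeakBialgebra k H} {WA : WeakBialgebra k A}
  {act : H →ₗ[k] A →ₗ[k] A} {coact : H →ₗ[k] H ⊗[k] A}

/-- The matched pair condition at `g = 1` and `x = 1`, as an identity of convolution products. -/
lemma conv_comul_act_one_coact (hP : IsWeakMatchedPair k WH WA act coact) :
    conv WH ((inclAA k H A).toLinearMap ∘ₗ WA.comul ∘ₗ act.flip 1)
        ((inclHA k H A).toLinearMap ∘ₗ coact) =
      conv WH
        ((inclAA k H A).toLinearMap ∘ₗ (pairMapA k act coact ∘ₗ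
            (TensorProduct.mk k (H ⊗[k] H) (A ⊗[k] A)).flip (WA.comul 1)) ∘ₗ WH.comul)
        ((inclHA k H A).toLinearMap ∘ₗ (pairMapH k act coact ∘ₗ
            (TensorProduct.mk k (H ⊗[k] H) (H ⊗[k] A)).flip (coact 1)) ∘ₗ WH.comul) := by
  ext h
  have h₃ := hP.cond3 h 1 1
  rw [mpLHS, mpRHS, assoc_symm_threeComul, lTensor_mul_comm_map, LinearMap.mulRight_one,
    LinearMap.comp_id, ← LinearMap.comp_apply (TensorProduct.map _ _) (TensorProduct.map _ _),
    ← TensorProduct.map_comp, lTensor_mul_comm_map] at h₃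
  exact h₃

/-- The map `h ↦ 1₁ (h⁰ · 1) ⊗ 1₂ h¹`. -/
def actOneCoact (WA : WeakBialgebra k A)
    (act : H →ₗ[k] A →ₗ[k] A) (coact : H →ₗ[k] H ⊗[k] A) : H →ₗ[k] A ⊗[k] A :=
  LinearMap.mulLeft k (WA.comul 1) ∘ₗ LinearMap.rTensor A (act.flip 1) ∘ₗ coact

lemma actOneCoact_apply (h : H) :
    actOneCoact WA act coact h = WA.comul 1 * LinearMap.rTensor A (act.flip 1) (coact h) := rfl

lemma pairMapA_comul_one (hCP : IsCompatiblePair k WH WA act coact) :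
    (pairMapA k act coact ∘ₗ
        (TensorProduct.mk k (H ⊗[k] H) (A ⊗[k] A)).flip (WA.comul 1)) ∘ₗ WH.comul =
      conv WH (actOneCoact WA act coact)
        (includeRight.toLinearMap ∘ₗ act.flip 1) := by
  rw [conv, ← LinearMap.comp_assoc]
  congr 1
  ext g h
  set inner : (H ⊗[k] A) ⊗[k] A →ₗ[k] A ⊗[k] A :=
    LinearMap.rTensor A (TensorProduct.lift act) ∘ₗ
      (TensorProduct.assoc k H A A).symm.toLinearMap ∘ₗ
      LinearMap.lTensor H (TensorProduct.comm k A A).toLinearMap ∘ₗ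
      (TensorProduct.assoc k H A A).toLinearMap with h_inner
  have h₁ : ∀ v : A ⊗[k] A, pairMapA k act coact ((g ⊗ₜ h) ⊗ₜ v) =
      LinearMap.lTensor A (LinearMap.mul' k A) (TensorProduct.assoc k A A A
        (LinearMap.rTensor A inner
          (TensorProduct.map (TensorProduct.mk k (H ⊗[k] A) A (coact g)) (act h) v))) := by
    intro v
    induction v with
    | zero => simp
    | add x y hx hy => simp only [map_add, TensorProduct.tmul_add, hx, hy]
    | tmul a c => simp [pairMapA, h_inner]
  have h₂ : ∀ u : H ⊗[k] A,
      LinearMap.lTensor A (LinearMap.mul' k A) (TensorProduct.assoc k A A A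
        (LinearMap.rTensor A inner
          (TensorProduct.map (TensorProduct.mk k (H ⊗[k] A) A u) (act h) (WA.comul 1)))) =
      WA.comul 1 * LinearMap.rTensor A (act.flip 1) u * 1 ⊗ₜ act h 1 := by
    intro u
    induction u with
    | zero => simp
    | add x y hx hy =>
      simp only [map_add, TensorProduct.map_add_left, LinearMap.add_apply, mul_add, add_mul,
        hx, hy]
    | tmul b d =>
      have h₃ : ∀ v : A ⊗[k] A,
          LinearMap.lTensor A (LinearMap.mul' k A) (TensorProduct.assoc k A A A
            (LinearMap.rTensor A inner
              (TensorProduct.map (TensorProduct.mk k (H ⊗[k] A) A (b ⊗ₜ d)) (act h) v))) =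
          1 ⊗ₜ d * TensorProduct.map (act b) (act h) v := by
        intro v
        induction v with
        | zero => simp
        | add x y hx hy => simp only [map_add, mul_add, hx, hy]
        | tmul a c => simp [h_inner]
      have h₄ : ∀ (x y : A) (v : A ⊗[k] A),
          TensorProduct.map (LinearMap.mulLeft k x) (LinearMap.mulLeft k y) v = x ⊗ₜ y * v := by
        intro x y v
        induction v with
        | zero => simp
        | add x y hx hy => simp only [map_add, mul_add, hx, hy]
        | tmul a c => simp
      rw [h₃, hCP.compat2, h₄, ← mul_assoc, tensor_mul_comm hCP.comm hCP.comm _ (WA.comul 1),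
        mul_assoc]
      simp
  simpa [actOneCoact] using (h₁ _).trans (h₂ _)

lemma conv_act_one_εs (hCP : IsCompatiblePair k WH WA act coact) :
    conv WH (act.flip 1) (WA.εs ∘ₗ act.flip 1) = act.flip 1 := by
  ext h
  have h₁ : ∀ t : H ⊗[k] H, LinearMap.mul' k A
      (TensorProduct.map (act.flip 1) (WA.εs ∘ₗ act.flip 1) t) =
      (TensorProduct.rid k A)
        ((TensorProduct.map (TensorProduct.lift act)
            (WA.counit ∘ₗ TensorProduct.lift act))
          ((TensorProduct.tensorTensorTensorComm k H H A A) (t ⊗ₜ[k] WA.comul 1))) := by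
    intro t
    induction t with
    | zero => simp
    | add x y hx hy => simp only [map_add, TensorProduct.add_tmul, hx, hy]
    | tmul a b =>
      have h₂ : ∀ v : A ⊗[k] A, (TensorProduct.rid k A)
        ((TensorProduct.map (TensorProduct.lift act)
            (WA.counit ∘ₗ TensorProduct.lift act))
          ((TensorProduct.tensorTensorTensorComm k H H A A) ((a ⊗ₜ b) ⊗ₜ[k] v))) =
          TensorProduct.rid k A (LinearMap.lTensor A WA.counit
            (TensorProduct.map (act a) (act b) v)) := by
        intro v
        induction v with
        | zero => simp
        | add x y hx hy => simp only [map_add, TensorProduct.tmul_add, hx, hy]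
        | tmul c d => simp
      have h₃ : ∀ (x y : A) (v : A ⊗[k] A),
          TensorProduct.rid k A (LinearMap.lTensor A WA.counit
            (TensorProduct.map (LinearMap.mulLeft k x) (LinearMap.mulLeft k y) v)) =
          x * TensorProduct.rid k A (LinearMap.lTensor A WA.counit (1 ⊗ₜ y * v)) := by
        intro x y v
        induction v with
        | zero => simp
        | add x y hx hy => simp only [map_add, mul_add, hx, hy]
        | tmul c d => simp
      rw [h₂, hCP.compat2, h₃, ← WA.εs_apply]
      simp
  rw [conv_apply, h₁, ← hCP.compat1, LinearMap.flip_apply]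

lemma conv_rTensor_coact (hCP : IsCompatiblePair k WH WA act coact) :
    conv WH (LinearMap.rTensor A (act.flip 1) ∘ₗ coact)
        (LinearMap.rTensor A WA.εs ∘ₗ LinearMap.rTensor A (act.flip 1) ∘ₗ coact) =
      LinearMap.rTensor A (act.flip 1) ∘ₗ coact := by
  have h₁ : ∀ f : H →ₗ[k] A, LinearMap.rTensor A f ∘ₗ coact =
      coactConv coact ((includeLeft : A →ₐ[k] A ⊗[k] A).toLinearMap ∘ₗ f)
        (includeRight : A →ₐ[k] A ⊗[k] A).toLinearMap := by
    intro f
    rw [coactConv_eq_comp coact (LinearMap.rTensor A f)]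
    simp
  rw [← LinearMap.comp_assoc coact, ← LinearMap.rTensor_comp, h₁, h₁,
    ← coactConv_conv hCP.pair.comoduleCoalgebra _ _ _ (by simp), ← map_conv,
    conv_act_one_εs hCP]

/-- The map `h ↦ εt(h⁰ · 1) h¹`. -/
def counitActOneCoact (WA : WeakBialgebra k A)
    (act : H →ₗ[k] A →ₗ[k] A) (coact : H →ₗ[k] H ⊗[k] A) : H →ₗ[k] A :=
  (TensorProduct.lid k A).toLinearMap ∘ₗ LinearMap.rTensor A WA.counit ∘ₗ
    actOneCoact WA act coact

lemma conv_actOneCoact_counit (hCP : IsCompatiblePair k WH WA act coact) :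
    conv WH (actOneCoact WA act coact)
        (includeRight.toLinearMap ∘ₗ counitActOneCoact WA act coact) =
      actOneCoact WA act coact := by
  conv_rhs => rw [actOneCoact, ← conv_rTensor_coact hCP]
  rw [← LinearMap.id_comp (conv WH (actOneCoact WA act coact) _)]
  apply comp_conv_congr
  intro a b
  simp only [LinearMap.id_apply, LinearMap.comp_apply, actOneCoact, LinearMap.mulLeft_apply,
    AlgHom.toLinearMap_apply, counitActOneCoact, Algebra.TensorProduct.includeRight_apply,
    LinearEquiv.coe_coe]
  rw [tensor_mul_comm hCP.comm hCP.comm (WA.comul 1), mul_assoc,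
    WA.comul_one_mul_counit hCP.comm, ← mul_assoc,
    tensor_mul_comm hCP.comm hCP.comm _ (WA.comul 1), mul_assoc]

lemma conv_act_one_coact_eq (R : H →ₗ[k] H ⊗[k] A)
    (hR : conv WH ((inclAA k H A).toLinearMap ∘ₗ WA.comul ∘ₗ act.flip 1)
        ((inclHA k H A).toLinearMap ∘ₗ coact) =
      conv WH ((inclAA k H A).toLinearMap ∘ₗ conv WH (actOneCoact WA act coact)
        (includeRight.toLinearMap ∘ₗ act.flip 1)) ((inclHA k H A).toLinearMap ∘ₗ R)) :
    conv WH (includeRight.toLinearMap ∘ₗ act.flip 1) coact =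
      conv WH (includeRight.toLinearMap ∘ₗ
        conv WH (counitActOneCoact WA act coact) (act.flip 1)) R := by
  set E : (A ⊗[k] H) ⊗[k] A →ₗ[k] H ⊗[k] A :=
    LinearMap.rTensor A ((TensorProduct.lid k H).toLinearMap ∘ₗ LinearMap.rTensor H WA.counit)
    with hE
  have hE' : ∀ (u : A ⊗[k] A) (v : H ⊗[k] A), E (inclAA k H A u * inclHA k H A v) =
      1 ⊗ₜ (TensorProduct.lid k A (LinearMap.rTensor A WA.counit u)) * v := by
    intro u v
    induction u with
    | zero => simp
    | add x y hx hy => simp only [map_add, add_mul, TensorProduct.tmul_add, hx, hy]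
    | tmul a b =>
      induction v with
      | zero => simp
      | add x y hx hy => simp only [map_add, mul_add, hx, hy]
      | tmul d e => simp [hE, TensorProduct.smul_tmul]
  have h₁ : ∀ (f : H →ₗ[k] A ⊗[k] A) (g : H →ₗ[k] H ⊗[k] A),
      E ∘ₗ conv WH ((inclAA k H A).toLinearMap ∘ₗ f) ((inclHA k H A).toLinearMap ∘ₗ g) =
      conv WH (includeRight.toLinearMap ∘ₗ ((TensorProduct.lid k A).toLinearMap ∘ₗ
        LinearMap.rTensor A WA.counit ∘ₗ f)) g := by
    intro f g
    refine Eq.trans (comp_conv_congr WH E LinearMap.id ?_) (LinearMap.id_comp _)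
    intro a b
    simpa using hE' (f a) (g b)
  have h₂ := congrArg (E ∘ₗ ·) hR
  simp only [h₁] at h₂
  have h₃ : (TensorProduct.lid k A).toLinearMap ∘ₗ LinearMap.rTensor A WA.counit ∘ₗ
      WA.comul ∘ₗ act.flip 1 = act.flip 1 := by
    ext h
    exact WA.counit_comul _
  have h₄ : (TensorProduct.lid k A).toLinearMap ∘ₗ LinearMap.rTensor A WA.counit ∘ₗ
      conv WH (actOneCoact WA act coact) (includeRight.toLinearMap ∘ₗ act.flip 1) =
      conv WH (counitActOneCoact WA act coact) (act.flip 1) := by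
    rw [← LinearMap.id_comp (conv WH (counitActOneCoact WA act coact) _),
      ← LinearMap.comp_assoc]
    apply comp_conv_congr
    intro a b
    simp only [counitActOneCoact, LinearMap.comp_apply, LinearMap.id_apply,
      AlgHom.toLinearMap_apply, Algebra.TensorProduct.includeRight_apply, LinearEquiv.coe_coe]
    generalize actOneCoact WA act coact a = u
    induction u with
    | zero => simp
    | add x y hx hy => simp only [map_add, add_mul, hx, hy]
    | tmul c d => simp
  rwa [h₃, h₄] at h₂

/-- The identity `(h₁ · 1)₁ ⊗ h₂⁰ ⊗ (h₁ · 1)₂ h₂¹ = 1₁ (h₁⁰ · 1) ⊗ h₂⁰ ⊗ 1₂ h₁¹ h₂¹ (h₃ · 1)`. -/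
lemma conv_comul_act_one_coact_eq (hCP : IsCompatiblePair k WH WA act coact) :
    conv WH ((inclAA k H A).toLinearMap ∘ₗ WA.comul ∘ₗ act.flip 1)
        ((inclHA k H A).toLinearMap ∘ₗ coact) =
      conv WH ((inclAA k H A).toLinearMap ∘ₗ actOneCoact WA act coact)
        (conv WH ((inclHA k H A).toLinearMap ∘ₗ coact)
          (includeRight.toLinearMap ∘ₗ act.flip 1)) := by
  have hR := conv_comul_act_one_coact hCP.pair
  rw [pairMapA_comul_one hCP] at hR
  set R := (pairMapH k act coact ∘ₗ
    (TensorProduct.mk k (H ⊗[k] H) (H ⊗[k] A)).flip (coact 1)) ∘ₗ WH.comul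
  have hQ := conv_act_one_coact_eq R hR
  have hr : ∀ f : H →ₗ[k] A, (inclHA k H A).toLinearMap ∘ₗ includeRight.toLinearMap ∘ₗ f =
      includeRight.toLinearMap ∘ₗ f := by
    intro f
    ext h
    simp [Algebra.TensorProduct.one_def]
  have hr' : ∀ f : H →ₗ[k] A, (inclAA k H A).toLinearMap ∘ₗ includeRight.toLinearMap ∘ₗ f =
      includeRight.toLinearMap ∘ₗ f := by
    intro f
    ext h
    simp [Algebra.TensorProduct.one_def]
  have hQ' : conv WH ((inclHA k H A).toLinearMap ∘ₗ coact)
          (includeRight.toLinearMap ∘ₗ act.flip 1) =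
      conv WH (includeRight.toLinearMap ∘ₗ counitActOneCoact WA act coact)
        (conv WH (includeRight.toLinearMap ∘ₗ act.flip 1) ((inclHA k H A).toLinearMap ∘ₗ R)) := by
    rw [conv_comm WH hCP.cocomm, ← hr, ← map_conv, hQ, map_conv, hr, map_conv, hr, conv_assoc]
    intro a b
    simp only [LinearMap.comp_apply, AlgHom.toLinearMap_apply,
      Algebra.TensorProduct.includeRight_apply]
    generalize coact a = u
    induction u with
    | zero => simp
    | add x y hx hy => simp only [map_add, add_mul, mul_add, hx, hy]
    | tmul c d => simp [hCP.comm]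
  rw [hQ', ← conv_assoc, ← hr' (counitActOneCoact WA act coact), ← map_conv,
    conv_actOneCoact_counit hCP, hR, map_conv, hr', conv_assoc]

end CompatiblePair

section SmashCoproduct

variable {k H A : Type*} [Field k] [Ring H] [Algebra k H] [Ring A] [Algebra k A]

open Algebra.TensorProduct (includeLeft includeRight)

variable (k H A) in
/-- The inclusion `a ⊗ c ↦ (a ⊗ 1) ⊗ (c ⊗ 1)`. -/
def inclAA₂ : A ⊗[k] A →ₐ[k] (A ⊗[k] H) ⊗[k] (A ⊗[k] H) :=
  Algebra.TensorProduct.map includeLeft includeLeft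

variable (k H A) in
/-- The inclusion `h ⊗ c ↦ (1 ⊗ h) ⊗ (c ⊗ 1)`. -/
def inclHA₂ : H ⊗[k] A →ₐ[k] (A ⊗[k] H) ⊗[k] (A ⊗[k] H) :=
  Algebra.TensorProduct.map includeRight includeLeft

variable (k H A) in
/-- The inclusion `h ↦ (1 ⊗ 1) ⊗ (1 ⊗ h)`. -/
def inclH₂ : H →ₐ[k] (A ⊗[k] H) ⊗[k] (A ⊗[k] H) :=
  includeRight.comp includeRight

variable (k H A) in
/-- The inclusion `c ↦ (1 ⊗ 1) ⊗ (c ⊗ 1)`. -/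
def inclA₂ : A →ₐ[k] (A ⊗[k] H) ⊗[k] (A ⊗[k] H) :=
  includeRight.comp includeLeft

@[simp]
lemma inclAA₂_tmul (a c : A) : inclAA₂ k H A (a ⊗ₜ c) = (a ⊗ₜ 1) ⊗ₜ (c ⊗ₜ 1) := by
  simp [inclAA₂]

@[simp]
lemma inclHA₂_tmul (h : H) (c : A) : inclHA₂ k H A (h ⊗ₜ c) = (1 ⊗ₜ h) ⊗ₜ (c ⊗ₜ 1) := by
  simp [inclHA₂]

@[simp]
lemma inclH₂_apply (h : H) : inclH₂ k H A h = (1 ⊗ₜ 1) ⊗ₜ (1 ⊗ₜ h) := rfl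

@[simp]
lemma inclA₂_apply (c : A) : inclA₂ k H A c = (1 ⊗ₜ 1) ⊗ₜ (c ⊗ₜ 1) := rfl

variable (WH : WeakBialgebra k H) (WA : WeakBialgebra k A)
  (act : H →ₗ[k] A →ₗ[k] A) (coact : H →ₗ[k] H ⊗[k] A)

/-- The map `h ↦ (1 ⊗ h₁⁰) ⊗ (h₁¹ ⊗ h₂)`. -/
def coactComul : H →ₗ[k] (A ⊗[k] H) ⊗[k] (A ⊗[k] H) :=
  conv WH ((inclHA₂ k H A).toLinearMap ∘ₗ coact) (inclH₂ k H A).toLinearMap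

lemma smashComul_tmul (x : A) (h : H) :
    smashComul k WH WA coact (x ⊗ₜ h) =
      inclAA₂ k H A (WA.comul x) * coactComul WH coact h := by
  rw [coactComul, conv_apply]
  simp only [smashComul, LinearMap.comp_apply, TensorProduct.map_tmul]
  generalize WA.comul x = u
  generalize WH.comul h = t
  induction t with
  | zero => simp
  | add x y hx hy => simp only [map_add, mul_add, TensorProduct.tmul_add, hx, hy]
  | tmul a b =>
    simp only [LinearMap.lTensor_tmul, LinearMap.rTensor_tmul, TensorProduct.map_tmul,
      LinearMap.mul'_apply, LinearMap.comp_apply, AlgHom.toLinearMap_apply, LinearEquiv.coe_coe,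
      TensorProduct.assoc_symm_tmul]
    generalize coact a = v
    induction u with
    | zero => simp
    | add x y hx hy => simp only [map_add, add_mul, TensorProduct.add_tmul, hx, hy]
    | tmul c d =>
      induction v with
      | zero => simp
      | add x y hx hy =>
        simp only [map_add, add_mul, mul_add, TensorProduct.add_tmul, TensorProduct.tmul_add,
          hx, hy]
      | tmul e f => simp

/-- The map `h ↦ 1 ♯ h = (h₁ · 1) ⊗ h₂`. -/
def underOne : H →ₗ[k] A ⊗[k] H :=
  conv WH (includeLeft.toLinearMap ∘ₗ act.flip 1) includeRight.toLinearMap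

set_option synthInstance.maxHeartbeats 200000 in
lemma projUnder_tmul (x : A) (h : H) :
    projUnder k WH act (x ⊗ₜ h) = x ⊗ₜ 1 * underOne WH act h := by
  rw [underOne, conv_apply]
  simp only [projUnder, smashMul, LinearMap.comp_apply, LinearMap.flip_apply,
    TensorProduct.mk_apply, LinearMap.rTensor_tmul, LinearMap.lTensor_tmul]
  generalize WH.comul h = t
  induction t with
  | zero => simp
  | add x y hx hy => simp only [map_add, mul_add, TensorProduct.add_tmul,
      TensorProduct.tmul_add, hx, hy]
  | tmul a b => simp

lemma projUnder_tmul_one_mul (x : A) (m : A ⊗[k] H) :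
    projUnder k WH act (x ⊗ₜ 1 * m) = x ⊗ₜ 1 * projUnder k WH act m := by
  induction m with
  | zero => simp
  | add x y hx hy => simp only [map_add, mul_add, hx, hy]
  | tmul a b =>
    rw [Algebra.TensorProduct.tmul_mul_tmul, one_mul, projUnder_tmul, projUnder_tmul, ← mul_assoc,
      Algebra.TensorProduct.tmul_mul_tmul, one_mul]

lemma map_projUnder_inclAA₂_mul (u : A ⊗[k] A) (w : (A ⊗[k] H) ⊗[k] (A ⊗[k] H)) :
    TensorProduct.map (projUnder k WH act) (projUnder k WH act) (inclAA₂ k H A u * w) =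
      inclAA₂ k H A u * TensorProduct.map (projUnder k WH act) (projUnder k WH act) w := by
  induction u with
  | zero => simp
  | add x y hx hy => simp only [map_add, add_mul, hx, hy]
  | tmul a c =>
    induction w with
    | zero => simp
    | add x y hx hy => simp only [map_add, mul_add, hx, hy]
    | tmul m n =>
      rw [inclAA₂_tmul, Algebra.TensorProduct.tmul_mul_tmul, TensorProduct.map_tmul,
        projUnder_tmul_one_mul, projUnder_tmul_one_mul, TensorProduct.map_tmul,
        Algebra.TensorProduct.tmul_mul_tmul]

variable {WH WA act coact}

lemma smashComul_projUnder_tmul (x : A) (h : H) :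
    smashComul k WH WA coact (projUnder k WH act (x ⊗ₜ h)) =
      inclAA₂ k H A (WA.comul x) *
        conv WH ((inclAA₂ k H A).toLinearMap ∘ₗ WA.comul ∘ₗ act.flip 1)
          (coactComul WH coact) h := by
  rw [projUnder_tmul, underOne]
  have key := comp_conv_congr WH (f := includeLeft.toLinearMap ∘ₗ act.flip 1)
    (g := includeRight.toLinearMap)
    (f' := (inclAA₂ k H A).toLinearMap ∘ₗ WA.comul ∘ₗ act.flip 1) (g' := coactComul WH coact)
    (smashComul k WH WA coact ∘ₗ LinearMap.mulLeft k (x ⊗ₜ 1))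
    (LinearMap.mulLeft k (inclAA₂ k H A (WA.comul x))) ?_
  · exact LinearMap.congr_fun key h
  · intro a b
    simp only [LinearMap.comp_apply, LinearMap.mulLeft_apply, AlgHom.toLinearMap_apply,
      Algebra.TensorProduct.includeLeft_apply, Algebra.TensorProduct.includeRight_apply,
      Algebra.TensorProduct.tmul_mul_tmul, one_mul, mul_one, smashComul_tmul, WA.comul_mul,
      map_mul, mul_assoc]

lemma map_projUnder_coactComul (hC : IsComoduleCoalgebra k WH WA coact) :
    TensorProduct.map (projUnder k WH act) (projUnder k WH act) ∘ₗ coactComul WH coact =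
      conv WH
        (conv WH ((inclAA₂ k H A).toLinearMap ∘ₗ LinearMap.rTensor A (act.flip 1) ∘ₗ coact)
          ((inclHA₂ k H A).toLinearMap ∘ₗ coact))
        (conv WH ((inclA₂ k H A).toLinearMap ∘ₗ act.flip 1) (inclH₂ k H A).toLinearMap) := by
  have h₁ : conv WH ((inclA₂ k H A).toLinearMap ∘ₗ act.flip 1) (inclH₂ k H A).toLinearMap =
      includeRight.toLinearMap ∘ₗ underOne WH act := by
    rw [underOne, map_conv]
    rfl
  have h₂ : conv WH ((inclAA₂ k H A).toLinearMap ∘ₗ LinearMap.rTensor A (act.flip 1) ∘ₗ coact)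
        ((inclHA₂ k H A).toLinearMap ∘ₗ coact) =
      coactConv coact ((includeLeft : A ⊗[k] H →ₐ[k] (A ⊗[k] H) ⊗[k] (A ⊗[k] H)).toLinearMap ∘ₗ
        underOne WH act) (inclA₂ k H A).toLinearMap := by
    rw [underOne, map_conv, coactConv_conv hC]
    · rw [← LinearMap.comp_assoc]
      congr 1 <;> refine (coactConv_eq_comp coact _ ?_).symm
      · intro a b
        simp [Algebra.TensorProduct.one_def]
      · intro a b
        simp [Algebra.TensorProduct.one_def]
    · intro a b
      simp
  rw [h₁, h₂, coactComul]
  refine (comp_conv_congr WH _ LinearMap.id ?_).trans (LinearMap.id_comp _)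
  intro a b
  rw [LinearMap.id_apply, coactConv_apply, LinearMap.comp_apply]
  generalize coact a = v
  induction v with
  | zero => simp
  | add x y hx hy => simp only [map_add, add_mul, hx, hy]
  | tmul e f =>
    simp [projUnder_tmul, ← Algebra.TensorProduct.one_def]

lemma smashComul_projUnder (hCP : IsCompatiblePair k WH WA act coact) (x : A) (h : H) :
    smashComul k WH WA coact (projUnder k WH act (x ⊗ₜ[k] h)) =
      (TensorProduct.map (projUnder k WH act) (projUnder k WH act))
        (smashComul k WH WA coact (x ⊗ₜ[k] h)) := by
  rw [smashComul_tmul, map_projUnder_inclAA₂_mul, smashComul_projUnder_tmul,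
    ← LinearMap.comp_apply (TensorProduct.map _ _), map_projUnder_coactComul
      hCP.pair.comoduleCoalgebra, coactComul, ← conv_assoc]
  set ι : (A ⊗[k] H) ⊗[k] A →ₐ[k] (A ⊗[k] H) ⊗[k] (A ⊗[k] H) :=
    Algebra.TensorProduct.map (AlgHom.id k _) includeLeft with hι
  have h₁ : ι.comp (inclAA k H A) = inclAA₂ k H A := by ext <;> simp [hι]
  have h₂ : ι.comp (inclHA k H A) = inclHA₂ k H A := by ext <;> simp [hι]
  have h₃ : ι.comp includeRight = inclA₂ k H A := by
    ext
    simp [hι, Algebra.TensorProduct.one_def]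
  have key := congrArg (ι.toLinearMap ∘ₗ ·) (conv_comul_act_one_coact_eq hCP)
  simp only [map_conv, ← LinearMap.comp_assoc, ← AlgHom.comp_toLinearMap, h₁, h₂, h₃] at key
  simp only [← LinearMap.comp_assoc]
  rw [key, conv_assoc, conv_assoc, conv_assoc]
  have absorb := comp_conv_congr WH
    (f := (inclAA₂ k H A).toLinearMap ∘ₗ actOneCoact WA act coact)
    (f' := (inclAA₂ k H A).toLinearMap ∘ₗ LinearMap.rTensor A (act.flip 1) ∘ₗ coact)
    (g := conv WH ((inclHA₂ k H A).toLinearMap ∘ₗ coact)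
      (conv WH ((inclA₂ k H A).toLinearMap ∘ₗ act.flip 1) (inclH₂ k H A).toLinearMap))
    (g' := conv WH ((inclHA₂ k H A).toLinearMap ∘ₗ coact)
      (conv WH ((inclA₂ k H A).toLinearMap ∘ₗ act.flip 1) (inclH₂ k H A).toLinearMap))
    (LinearMap.mulLeft k (inclAA₂ k H A (WA.comul x)))
    (LinearMap.mulLeft k (inclAA₂ k H A (WA.comul x))) ?_
  · exact LinearMap.congr_fun absorb h
  · intro a b
    simp only [LinearMap.mulLeft_apply, LinearMap.comp_apply, AlgHom.toLinearMap_apply,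
      actOneCoact_apply, map_mul]
    rw [← mul_assoc, ← mul_assoc, ← map_mul, WA.comul_mul_comul_one, mul_assoc]

end SmashCoproduct

section MulThree

variable {k M T : Type*} [Field k] [Ring M] [Algebra k M] [Ring T] [Algebra k T]

open Algebra.TensorProduct (includeLeft includeRight)

/-- The map `m ⊗ (n ⊗ p) ↦ j₁(m) j₂(n) j₃(p)`. -/
def mulThree (j₁ j₂ j₃ : M →ₐ[k] T) : M ⊗[k] (M ⊗[k] M) →ₗ[k] T :=
  LinearMap.mul' k T ∘ₗ TensorProduct.map j₁.toLinearMap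
    (LinearMap.mul' k T ∘ₗ TensorProduct.map j₂.toLinearMap j₃.toLinearMap)

variable {j₁ j₂ j₃ : M →ₐ[k] T}

lemma mulThree_assoc_tmul (h₁₂ : ∀ m n, Commute (j₁ m) (j₂ n)) (w : M ⊗[k] M) (m : M) :
    mulThree j₁ j₂ j₃ (TensorProduct.assoc k M M M (w ⊗ₜ m)) =
      Algebra.TensorProduct.lift j₁ j₂ h₁₂ w * j₃ m := by
  induction w with
  | zero => simp
  | add x y hx hy => simp only [map_add, add_mul, TensorProduct.add_tmul, hx, hy]
  | tmul a b => simp [mulThree, mul_assoc]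

lemma mulThree_tmul (h₂₃ : ∀ m n, Commute (j₂ m) (j₃ n)) (m : M) (w : M ⊗[k] M) :
    mulThree j₁ j₂ j₃ (m ⊗ₜ w) = j₁ m * Algebra.TensorProduct.lift j₂ j₃ h₂₃ w := by
  induction w with
  | zero => simp
  | add x y hx hy => simp only [map_add, mul_add, TensorProduct.tmul_add, hx, hy]
  | tmul a b => simp [mulThree]

lemma commute_lift_left (h₁₂ : ∀ m n, Commute (j₁ m) (j₂ n))
    (h₁₃ : ∀ m n, Commute (j₁ m) (j₃ n)) (h₂₃ : ∀ m n, Commute (j₂ m) (j₃ n))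
    (w : M ⊗[k] M) (m : M) : Commute (Algebra.TensorProduct.lift j₁ j₂ h₁₂ w) (j₃ m) := by
  induction w with
  | zero => simp
  | add x y hx hy => simpa only [map_add] using hx.add_left hy
  | tmul a b => simpa using (h₁₃ a m).mul_left (h₂₃ b m)

lemma commute_lift_right (h₁₂ : ∀ m n, Commute (j₁ m) (j₂ n))
    (h₁₃ : ∀ m n, Commute (j₁ m) (j₃ n)) (h₂₃ : ∀ m n, Commute (j₂ m) (j₃ n))
    (m : M) (w : M ⊗[k] M) : Commute (j₁ m) (Algebra.TensorProduct.lift j₂ j₃ h₂₃ w) := by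
  induction w with
  | zero => simp
  | add x y hx hy => simpa only [map_add] using hx.add_right hy
  | tmul a b => simpa using (h₁₂ m a).mul_right (h₁₃ m b)

variable (k M) in
lemma exists_mulThree_eq_id :
    ∃ j₁ j₂ j₃ : M →ₐ[k] M ⊗[k] (M ⊗[k] M), (∀ m n, Commute (j₁ m) (j₂ n)) ∧
      (∀ m n, Commute (j₁ m) (j₃ n)) ∧ (∀ m n, Commute (j₂ m) (j₃ n)) ∧
      mulThree j₁ j₂ j₃ = LinearMap.id := by
  refine ⟨includeLeft, includeRight.comp includeLeft, includeRight.comp includeRight,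
    fun m n ↦ ?_, fun m n ↦ ?_, fun m n ↦ ?_, ?_⟩
  · simp [commute_iff_eq]
  · simp [commute_iff_eq]
  · simp [commute_iff_eq]
  · apply TensorProduct.ext
    ext m
    simp [mulThree]

end MulThree

section Coassociativity

variable {k H A T : Type*} [Field k] [Ring H] [Algebra k H] [Ring A] [Algebra k A]
  [Ring T] [Algebra k T]

open Algebra.TensorProduct (includeLeft includeRight)

variable {j₁ j₂ j₃ : A ⊗[k] H →ₐ[k] T}

/-- The map `a ⊗ (c ⊗ d) ↦ j₁(a ⊗ 1) j₂(c ⊗ 1) j₃(d ⊗ 1)`. -/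
def mulAAA (j₁ j₂ j₃ : A ⊗[k] H →ₐ[k] T) : A ⊗[k] (A ⊗[k] A) →ₗ[k] T :=
  mulThree (j₁.comp includeLeft) (j₂.comp includeLeft) (j₃.comp includeLeft)

/-- The map `h ⊗ (c ⊗ d) ↦ j₁(1 ⊗ h) j₂(c ⊗ 1) j₃(d ⊗ 1)`. -/
def mulHAA (j₁ j₂ j₃ : A ⊗[k] H →ₐ[k] T) : H ⊗[k] (A ⊗[k] A) →ₗ[k] T :=
  LinearMap.mul' k T ∘ₗ TensorProduct.map (j₁.comp includeRight).toLinearMap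
    (LinearMap.mul' k T ∘ₗ TensorProduct.map (j₂.comp includeLeft).toLinearMap
      (j₃.comp includeLeft).toLinearMap)

lemma mulAAA_tmul (h₂₃ : ∀ m n, Commute (j₂ m) (j₃ n)) (a : A) (w : A ⊗[k] A) :
    mulAAA j₁ j₂ j₃ (a ⊗ₜ w) =
      j₁ (a ⊗ₜ 1) * Algebra.TensorProduct.lift j₂ j₃ h₂₃ (inclAA₂ k H A w) := by
  induction w with
  | zero => simp
  | add x y hx hy => simp only [map_add, mul_add, TensorProduct.tmul_add, hx, hy]
  | tmul c d => simp [mulAAA, mulThree]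

lemma mulHAA_tmul (h₂₃ : ∀ m n, Commute (j₂ m) (j₃ n)) (h : H) (w : A ⊗[k] A) :
    mulHAA j₁ j₂ j₃ (h ⊗ₜ w) =
      j₁ (1 ⊗ₜ h) * Algebra.TensorProduct.lift j₂ j₃ h₂₃ (inclAA₂ k H A w) := by
  induction w with
  | zero => simp
  | add x y hx hy => simp only [map_add, mul_add, TensorProduct.tmul_add, hx, hy]
  | tmul c d => simp [mulHAA]

lemma mulAAA_assoc_tmul (h₁₂ : ∀ m n, Commute (j₁ m) (j₂ n)) (w : A ⊗[k] A) (c : A) :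
    mulAAA j₁ j₂ j₃ (TensorProduct.assoc k A A A (w ⊗ₜ c)) =
      Algebra.TensorProduct.lift j₁ j₂ h₁₂ (inclAA₂ k H A w) * j₃ (c ⊗ₜ 1) := by
  induction w with
  | zero => simp
  | add x y hx hy => simp only [map_add, add_mul, TensorProduct.add_tmul, hx, hy]
  | tmul a b => simp [mulAAA, mulThree, mul_assoc]

lemma mulHAA_assoc_tmul (h₁₂ : ∀ m n, Commute (j₁ m) (j₂ n)) (v : H ⊗[k] A) (c : A) :
    mulHAA j₁ j₂ j₃ (TensorProduct.assoc k H A A (v ⊗ₜ c)) =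
      Algebra.TensorProduct.lift j₁ j₂ h₁₂ (inclHA₂ k H A v) * j₃ (c ⊗ₜ 1) := by
  induction v with
  | zero => simp
  | add x y hx hy => simp only [map_add, add_mul, TensorProduct.add_tmul, hx, hy]
  | tmul a b => simp [mulHAA, mul_assoc]

variable {WH : WeakBialgebra k H} {WA : WeakBialgebra k A} {coact : H →ₗ[k] H ⊗[k] A}

lemma mulThree_assoc_rTensor_smashComul (h₁₂ : ∀ m n, Commute (j₁ m) (j₂ n))
    (h₁₃ : ∀ m n, Commute (j₁ m) (j₃ n)) (h₂₃ : ∀ m n, Commute (j₂ m) (j₃ n))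
    (u : A ⊗[k] A) (a b : H) :
    mulThree j₁ j₂ j₃ (TensorProduct.assoc k (A ⊗[k] H) (A ⊗[k] H) (A ⊗[k] H)
      (LinearMap.rTensor (A ⊗[k] H) (smashComul k WH WA coact)
        (inclAA₂ k H A u * (inclHA₂ k H A (coact a) * inclH₂ k H A b)))) =
    mulAAA j₁ j₂ j₃ (TensorProduct.assoc k A A A (LinearMap.rTensor A WA.comul u)) *
      (coactConv coact
        ((Algebra.TensorProduct.lift j₁ j₂ h₁₂).toLinearMap ∘ₗ coactComul WH coact)
        (j₃.comp includeLeft).toLinearMap a * j₃ (1 ⊗ₜ b)) := by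
  rw [coactConv_apply]
  generalize coact a = v
  induction u with
  | zero => simp
  | add x y hx hy => simp only [map_add, add_mul, hx, hy]
  | tmul c d =>
    induction v with
    | zero => simp
    | add x y hx hy => simp only [map_add, add_mul, mul_add, hx, hy]
    | tmul e f =>
      have hdf : j₃ ((d * f) ⊗ₜ b) = j₃ (d ⊗ₜ 1) * (j₃ (f ⊗ₜ 1) * j₃ (1 ⊗ₜ b)) := by
        simp [← map_mul]
      simp only [inclAA₂_tmul, inclHA₂_tmul, inclH₂_apply, Algebra.TensorProduct.tmul_mul_tmul,
        one_mul, mul_one, LinearMap.rTensor_tmul, mulThree_assoc_tmul h₁₂, smashComul_tmul,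
        mulAAA_assoc_tmul h₁₂, TensorProduct.map_tmul, LinearMap.mul'_apply,
        LinearMap.comp_apply, AlgHom.toLinearMap_apply, AlgHom.comp_apply, map_mul,
        Algebra.TensorProduct.includeLeft_apply, hdf]
      simp only [mul_assoc]
      rw [← mul_assoc (Algebra.TensorProduct.lift j₁ j₂ h₁₂ (coactComul WH coact e)),
        (commute_lift_left h₁₂ h₁₃ h₂₃ _ (d ⊗ₜ 1)).eq]
      simp only [mul_assoc]

lemma mulThree_lTensor_smashComul (h₁₂ : ∀ m n, Commute (j₁ m) (j₂ n))
    (h₁₃ : ∀ m n, Commute (j₁ m) (j₃ n)) (h₂₃ : ∀ m n, Commute (j₂ m) (j₃ n))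
    (u : A ⊗[k] A) (a b : H) :
    mulThree j₁ j₂ j₃ (LinearMap.lTensor (A ⊗[k] H) (smashComul k WH WA coact)
        (inclAA₂ k H A u * (inclHA₂ k H A (coact a) * inclH₂ k H A b))) =
    mulAAA j₁ j₂ j₃ (LinearMap.lTensor A WA.comul u) *
      (mulHAA j₁ j₂ j₃ (LinearMap.lTensor H WA.comul (coact a)) *
        Algebra.TensorProduct.lift j₂ j₃ h₂₃ (coactComul WH coact b)) := by
  generalize coact a = v
  induction u with
  | zero => simp
  | add x y hx hy => simp only [map_add, add_mul, hx, hy]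
  | tmul c d =>
    induction v with
    | zero => simp
    | add x y hx hy => simp only [map_add, add_mul, mul_add, hx, hy]
    | tmul e f =>
      have hce : j₁ (c ⊗ₜ e) = j₁ (c ⊗ₜ 1) * j₁ (1 ⊗ₜ e) := by simp [← map_mul]
      simp only [inclAA₂_tmul, inclHA₂_tmul, inclH₂_apply, Algebra.TensorProduct.tmul_mul_tmul,
        one_mul, mul_one, LinearMap.lTensor_tmul, mulThree_tmul h₂₃, smashComul_tmul,
        mulAAA_tmul h₂₃, mulHAA_tmul h₂₃, WA.comul_mul, map_mul, hce]
      simp only [mul_assoc]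
      rw [← mul_assoc (j₁ (1 ⊗ₜ e)), (commute_lift_right h₁₂ h₁₃ h₂₃ (1 ⊗ₜ e) _).eq]
      simp only [mul_assoc]

lemma coactConv_coactComul (hC : IsComoduleCoalgebra k WH WA coact)
    (h₁₂ : ∀ m n, Commute (j₁ m) (j₂ n))
    (h₁₃ : ∀ m n, Commute (j₁ m) (j₃ n)) (h₂₃ : ∀ m n, Commute (j₂ m) (j₃ n)) :
    coactConv coact ((Algebra.TensorProduct.lift j₁ j₂ h₁₂).toLinearMap ∘ₗ coactComul WH coact)
        (j₃.comp includeLeft).toLinearMap =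
      conv WH (mulHAA j₁ j₂ j₃ ∘ₗ LinearMap.lTensor H WA.comul ∘ₗ coact)
        (((Algebra.TensorProduct.lift j₂ j₃ h₂₃).comp (inclHA₂ k H A)).toLinearMap ∘ₗ coact) := by
  rw [coactComul, map_conv, coactConv_conv hC]
  · congr 1
    · ext h
      rw [LinearMap.comp_apply, LinearMap.comp_apply, ← hC.coact_coact, coactConv_apply]
      generalize coact h = v
      induction v with
      | zero => simp
      | add x y hx hy => simp only [map_add, hx, hy]
      | tmul e f =>
        rw [LinearMap.rTensor_tmul, mulHAA_assoc_tmul h₁₂]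
        rfl
    · refine coactConv_eq_comp coact _ fun a b ↦ ?_
      simp [← Algebra.TensorProduct.one_def]
  · intro a h
    exact (commute_lift_left h₁₂ h₁₃ h₂₃ _ _).eq.symm

lemma lift_comp_coactComul (h₂₃ : ∀ m n, Commute (j₂ m) (j₃ n)) :
    (Algebra.TensorProduct.lift j₂ j₃ h₂₃).toLinearMap ∘ₗ coactComul WH coact =
      conv WH
        (((Algebra.TensorProduct.lift j₂ j₃ h₂₃).comp (inclHA₂ k H A)).toLinearMap ∘ₗ coact)
        (j₃.comp includeRight).toLinearMap := by
  rw [coactComul, map_conv, AlgHom.comp_toLinearMap, LinearMap.comp_assoc]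
  congr 1
  ext h
  simp [← Algebra.TensorProduct.one_def]

lemma mulThree_smashComul_coassoc (hC : IsComoduleCoalgebra k WH WA coact)
    (h₁₂ : ∀ m n, Commute (j₁ m) (j₂ n)) (h₁₃ : ∀ m n, Commute (j₁ m) (j₃ n))
    (h₂₃ : ∀ m n, Commute (j₂ m) (j₃ n)) (x : A) (h : H) :
    mulThree j₁ j₂ j₃ (TensorProduct.assoc k (A ⊗[k] H) (A ⊗[k] H) (A ⊗[k] H)
        (LinearMap.rTensor (A ⊗[k] H) (smashComul k WH WA coact)
          (smashComul k WH WA coact (x ⊗ₜ h)))) =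
      mulThree j₁ j₂ j₃ (LinearMap.lTensor (A ⊗[k] H) (smashComul k WH WA coact)
        (smashComul k WH WA coact (x ⊗ₜ h))) := by
  have hl := comp_conv_congr WH (f := (inclHA₂ k H A).toLinearMap ∘ₗ coact)
    (g := (inclH₂ k H A).toLinearMap)
    (f' := coactConv coact
        ((Algebra.TensorProduct.lift j₁ j₂ h₁₂).toLinearMap ∘ₗ coactComul WH coact)
        (j₃.comp includeLeft).toLinearMap)
    (g' := (j₃.comp includeRight).toLinearMap)
    (mulThree j₁ j₂ j₃ ∘ₗ
      (TensorProduct.assoc k (A ⊗[k] H) (A ⊗[k] H) (A ⊗[k] H)).toLinearMap ∘ₗ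
      LinearMap.rTensor (A ⊗[k] H) (smashComul k WH WA coact) ∘ₗ
      LinearMap.mulLeft k (inclAA₂ k H A (WA.comul x)))
    (LinearMap.mulLeft k (mulAAA j₁ j₂ j₃ (TensorProduct.assoc k A A A
      (LinearMap.rTensor A WA.comul (WA.comul x)))))
    (mulThree_assoc_rTensor_smashComul h₁₂ h₁₃ h₂₃ (WA.comul x))
  have hr := comp_conv_congr WH (f := (inclHA₂ k H A).toLinearMap ∘ₗ coact)
    (g := (inclH₂ k H A).toLinearMap)
    (f' := mulHAA j₁ j₂ j₃ ∘ₗ LinearMap.lTensor H WA.comul ∘ₗ coact)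
    (g' := (Algebra.TensorProduct.lift j₂ j₃ h₂₃).toLinearMap ∘ₗ coactComul WH coact)
    (mulThree j₁ j₂ j₃ ∘ₗ LinearMap.lTensor (A ⊗[k] H) (smashComul k WH WA coact) ∘ₗ
      LinearMap.mulLeft k (inclAA₂ k H A (WA.comul x)))
    (LinearMap.mulLeft k (mulAAA j₁ j₂ j₃ (LinearMap.lTensor A WA.comul (WA.comul x))))
    (mulThree_lTensor_smashComul h₁₂ h₁₃ h₂₃ (WA.comul x))
  rw [coactConv_coactComul hC h₁₂ h₁₃ h₂₃, conv_assoc, ← lift_comp_coactComul h₂₃,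
    WA.coassoc] at hl
  rw [smashComul_tmul]
  exact LinearMap.congr_fun (hl.trans hr.symm) h

lemma smashComul_coassoc (hC : IsComoduleCoalgebra k WH WA coact) (u : A ⊗[k] H) :
    TensorProduct.assoc k (A ⊗[k] H) (A ⊗[k] H) (A ⊗[k] H)
        (LinearMap.rTensor (A ⊗[k] H) (smashComul k WH WA coact) (smashComul k WH WA coact u)) =
      LinearMap.lTensor (A ⊗[k] H) (smashComul k WH WA coact) (smashComul k WH WA coact u) := by
  induction u with
  | zero => simp only [map_zero]
  | add x y hx hy => simp only [map_add, hx, hy]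
  | tmul x h =>
    obtain ⟨j₁, j₂, j₃, h₁₂, h₁₃, h₂₃, hj⟩ := exists_mulThree_eq_id k (A ⊗[k] H)
    have key := mulThree_smashComul_coassoc hC h₁₂ h₁₃ h₂₃ x h
    rw [hj] at key
    exact key

end Coassociativity

theorem underline_comul
    {k H A : Type*} [Field k] [Ring H] [Algebra k H] [Ring A] [Algebra k A]
    (WH : WeakBialgebra k H) (WA : WeakBialgebra k A)
    (act : H →ₗ[k] A →ₗ[k] A) (coact : H →ₗ[k] H ⊗[k] A)
    (hCP : IsCompatiblePair k WH WA act coact) :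
    (∀ (x : A) (h : H),
        smashComul k WH WA coact (projUnder k WH act (x ⊗ₜ[k] h)) =
          (TensorProduct.map (projUnder k WH act) (projUnder k WH act))
            (smashComul k WH WA coact (x ⊗ₜ[k] h))) ∧
    (∀ (x : A) (h : H),
        smashComul k WH WA coact (projUnder k WH act (x ⊗ₜ[k] h)) ∈
          LinearMap.range
            (TensorProduct.map (projUnder k WH act) (projUnder k WH act))) ∧
    (∀ u : A ⊗[k] H,
        (TensorProduct.assoc k (A ⊗[k] H) (A ⊗[k] H) (A ⊗[k] H))
            ((LinearMap.rTensor (A ⊗[k] H) (smashComul k WH WA coact))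
              (smashComul k WH WA coact u)) =
          (LinearMap.lTensor (A ⊗[k] H) (smashComul k WH WA coact))
            (smashComul k WH WA coact u)) := by
  exact ⟨smashComul_projUnder hCP, fun x h ↦ ⟨_, (smashComul_projUnder hCP x h).symm⟩,
    smashComul_coassoc hCP.pair.comoduleCoalgebra⟩

end WeakSmash
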